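/- arXiv:0903.4265 — 3 statements merged into one kernel-verified Lean document; each statement's English description precedes it below -/
import Mathlib

section
/- Let n ≥ 1, let l_1,…,l_n > 0 and m_1,…,m_n ≥ 0 be real numbers, and let φ : ℝ^n → ℝ be a smooth compactly supported function. Then the holomorphic function G(φ)(λ) = ∫_{ℝ^n} x_{1+}^{l_1λ+m_1} ⋯ x_{n+}^{l_nλ+m_n} φ(x) dx, defined for Re λ > L = -min_i (m_i+1)/l_i, extends to a meromorphic function on all of ℂ whose poles are contained in the set P = ∪_{i=1}^n { -(m_i+r)/l_i : r ∈ ℤ, r ≥ 1 }, and for each element -λ_j of P the order of the pole of this extension at λ = -λ_j is at most k_j = #S_j, where S_j = { 1 ≤ i ≤ n : there exists r ∈ ℤ_{>0} with (m_i+r)/l_i = λ_j }. -/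
open MeasureTheory Filter Set
open scoped Topology

/-- `x₊^s`: equals `x^s = exp(s log x)` for `x > 0` and `0` for `x ≤ 0`. -/
noncomputable def plusPow (x : ℝ) (s : ℂ) : ℂ := if 0 < x then (x : ℂ) ^ s else 0

/-- `G(φ)(λ) = ∫_{ℝⁿ} x₁₊^(l₁λ+m₁) ⋯ x_n₊^(l_nλ+m_n) φ(x) dx`. -/
noncomputable def Gint (n : ℕ) (l m : Fin n → ℝ) (φ : (Fin n → ℝ) → ℝ) (lam : ℂ) : ℂ :=
  ∫ x : Fin n → ℝ, (∏ i, plusPow (x i) ((l i : ℂ) * lam + (m i : ℂ))) * (φ x : ℂ)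

/-- The set of candidate poles `P = ∪_i {-(m_i+r)/l_i : r ∈ ℤ, r ≥ 1} ⊆ ℝ`. -/
def polesP (n : ℕ) (l m : Fin n → ℝ) : Set ℝ :=
  {t | ∃ i : Fin n, ∃ r : ℕ, 0 < r ∧ t = -((m i + (r : ℝ)) / l i)}

/-- `k_j = #S_j` where `S_j = {i : ∃ r ∈ ℤ_{>0}, (m_i+r)/l_i = μ}`. -/
noncomputable def kOrd (n : ℕ) (l m : Fin n → ℝ) (μ : ℝ) : ℕ :=
  Set.ncard {i : Fin n | ∃ r : ℕ, 0 < r ∧ (m i + (r : ℝ)) / l i = μ}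

/-- The integral of `∏ xᵢ₊^{sᵢ}` against `ψ`. -/
noncomputable def monomialIntegral {n : ℕ} (s : Fin n → ℂ) (ψ : (Fin n → ℝ) → ℝ) : ℂ :=
  ∫ x : Fin n → ℝ, (∏ i, plusPow (x i) (s i)) * (ψ x : ℂ)

lemma measurable_plusPow (s : ℂ) : Measurable fun x : ℝ => plusPow x s := by
  unfold plusPow
  refine Measurable.ite measurableSet_Ioi ?_ measurable_const
  exact Complex.measurable_ofReal.pow_const s

lemma norm_plusPow_le {x B A : ℝ} {s : ℂ} (hB : 1 ≤ B) (hx : x ≤ B) (hs : 0 ≤ s.re)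
    (hA : s.re ≤ A) : ‖plusPow x s‖ ≤ B ^ A := by
  unfold plusPow
  split_ifs with h
  · rw [Complex.norm_cpow_eq_rpow_re_of_pos h]
    exact (Real.rpow_le_rpow h.le hx hs).trans (Real.rpow_le_rpow_of_exponent_le hB hA)
  · simp only [norm_zero]; positivity

lemma hasDerivAt_plusPow (x a b : ℝ) (z : ℂ) :
    HasDerivAt (fun z : ℂ => plusPow x (a * z + b))
      (a * Real.log x * plusPow x (a * z + b)) z := by
  unfold plusPow
  split_ifs with h
  · have h1 : HasDerivAt (fun z : ℂ => (a : ℂ) * z + b) a z := by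
      simpa using ((hasDerivAt_id z).const_mul (a : ℂ)).add_const (b : ℂ)
    have := h1.const_cpow (c := (x : ℂ)) (Or.inl (by exact_mod_cast h.ne'))
    convert this using 1
    rw [Complex.ofReal_log h.le]; ring
  · simpa using hasDerivAt_const z (0 : ℂ)

lemma hasDerivAt_prod_plusPow {n : ℕ} (x l m : Fin n → ℝ) (T : Finset (Fin n)) (z : ℂ) :
    HasDerivAt (fun z : ℂ => ∏ i ∈ T, plusPow (x i) (l i * z + m i))
      ((∑ i ∈ T, (l i : ℂ) * Real.log (x i)) * ∏ i ∈ T, plusPow (x i) (l i * z + m i)) z := by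
  classical
  induction T using Finset.induction_on with
  | empty => simpa using hasDerivAt_const z (1 : ℂ)
  | insert a T ha ih =>
    simp only [Finset.prod_insert ha, Finset.sum_insert ha]
    refine ((hasDerivAt_plusPow (x a) (l a) (m a) z).mul ih).congr_deriv ?_
    ring

lemma measurable_prod_plusPow {n : ℕ} (s : Fin n → ℂ) :
    Measurable fun x : Fin n → ℝ => ∏ i, plusPow (x i) (s i) :=
  Finset.measurable_fun_prod _ fun i _ => (measurable_plusPow (s i)).comp (measurable_pi_apply i)

lemma exists_abs_le_of_hasCompactSupport {n : ℕ} {ψ : (Fin n → ℝ) → ℝ}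
    (hc : HasCompactSupport ψ) : ∃ R : ℝ, 1 ≤ R ∧ ∀ x, ψ x ≠ 0 → ∀ i, |x i| ≤ R := by
  obtain ⟨R, hR⟩ := hc.isCompact.isBounded.exists_norm_le
  refine ⟨max 1 R, le_max_left _ _, fun x hx i => ?_⟩
  exact (norm_le_pi_norm x i).trans ((hR x (subset_tsupport _ hx)).trans (le_max_right _ _))

lemma integrable_indicator_cpow {s : ℂ} (hs : -1 < s.re) {R : ℝ} (hR : 0 ≤ R) :
    Integrable ((Ioc 0 R).indicator fun t : ℝ => (t : ℂ) ^ s) := by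
  rw [integrable_indicator_iff measurableSet_Ioc]
  have := intervalIntegral.intervalIntegrable_cpow' (a := 0) (b := R) hs
  rwa [intervalIntegrable_iff_integrableOn_Ioc_of_le hR] at this

lemma indicator_cpow_eq_plusPow {s : ℂ} {R t : ℝ} (ht : |t| ≤ R) :
    (Ioc 0 R).indicator (fun t : ℝ => (t : ℂ) ^ s) t = plusPow t s := by
  unfold plusPow
  split_ifs with h
  · exact indicator_of_mem (show t ∈ Ioc 0 R from ⟨h, (le_abs_self t).trans ht⟩) _
  · exact indicator_of_notMem (fun h' => h h'.1) _

lemma integrable_plusPow_mul {s : ℂ} (hs : -1 < s.re) {g : ℝ → ℝ} (hg : Continuous g)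
    {R : ℝ} (hR : 0 ≤ R) (hgR : ∀ t, g t ≠ 0 → |t| ≤ R) :
    Integrable fun t : ℝ => plusPow t s * (g t : ℂ) := by
  have hc : HasCompactSupport g := by
    refine HasCompactSupport.intro (isCompact_Icc (a := -R) (b := R)) fun t ht => ?_
    by_contra h
    exact ht (abs_le.1 (hgR t h))
  obtain ⟨C, hC⟩ := hg.bounded_above_of_compact_support hc
  have := (integrable_indicator_cpow hs hR).mul_bdd (c := C) (g := fun t => (g t : ℂ))
    (Complex.continuous_ofReal.comp hg).aestronglyMeasurable
    (Eventually.of_forall fun t => by simpa using hC t)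
  refine this.congr (Eventually.of_forall fun t => ?_)
  by_cases h : g t = 0
  · simp [h]
  · simp only [indicator_cpow_eq_plusPow (hgR t h)]

lemma integrable_prod_plusPow_mul {n : ℕ} {s : Fin n → ℂ} (hs : ∀ i, -1 < (s i).re)
    {ψ : (Fin n → ℝ) → ℝ} (hψ : Continuous ψ) (hc : HasCompactSupport ψ) :
    Integrable fun x : Fin n → ℝ => (∏ i, plusPow (x i) (s i)) * (ψ x : ℂ) := by
  obtain ⟨R, hR1, hR⟩ := exists_abs_le_of_hasCompactSupport hc
  obtain ⟨C, hC⟩ := hψ.bounded_above_of_compact_support hc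
  have h1 : Integrable fun x : Fin n → ℝ =>
      ∏ i, (Ioc 0 R).indicator (fun t : ℝ => (t : ℂ) ^ (s i)) (x i) :=
    Integrable.fintype_prod fun i => integrable_indicator_cpow (hs i) (by linarith)
  have := h1.mul_bdd (c := C) (g := fun x => (ψ x : ℂ))
    (Complex.continuous_ofReal.comp hψ).aestronglyMeasurable
    (Eventually.of_forall fun t => by simpa using hC t)
  refine this.congr (Eventually.of_forall fun x => ?_)
  by_cases h : ψ x = 0
  · simp [h]
  · simp only [indicator_cpow_eq_plusPow (hR x h _)]

lemma integral_plusPow_mul_eq {s : ℂ} (hs : -1 < s.re) {g g' : ℝ → ℝ}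
    (hg : ∀ t, HasDerivAt g (g' t) t) (hg' : Continuous g')
    {R : ℝ} (hR : 0 ≤ R) (hgR : ∀ t, g t ≠ 0 → |t| ≤ R) (hgR' : ∀ t, g' t ≠ 0 → |t| ≤ R) :
    ∫ t : ℝ, plusPow t s * (g t : ℂ)
      = (-(s + 1))⁻¹ * ∫ t : ℝ, plusPow t (s + 1) * (g' t : ℂ) := by
  have hs1 : 0 < (s + 1).re := by simp; linarith
  have hs0 : s + 1 ≠ 0 := fun h => by rw [h] at hs1; simp at hs1
  have hsn : s ≠ -1 := fun h => hs0 (by rw [h]; ring)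
  have hgc : Continuous g := continuous_iff_continuousAt.2 fun t => (hg t).continuousAt
  have e : ∀ (a : ℂ) (h : ℝ → ℝ), ∫ t : ℝ, plusPow t a * (h t : ℂ)
      = ∫ t in Ioi (0 : ℝ), (h t : ℂ) * (t : ℂ) ^ a := by
    intro a h
    rw [← integral_indicator measurableSet_Ioi]
    congr 1; ext t
    by_cases ht : 0 < t <;> simp [plusPow, indicator, ht, mul_comm]
  have ei : ∀ (a : ℂ) (h : ℝ → ℝ), -1 < a.re → Continuous h → (∀ t, h t ≠ 0 → |t| ≤ R) →
      IntegrableOn (fun t : ℝ => (h t : ℂ) * (t : ℂ) ^ a) (Ioi 0) := by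
    intro a h ha hh hR'
    refine (integrable_plusPow_mul ha hh hR hR').integrableOn.congr_fun ?_ measurableSet_Ioi
    intro t ht
    simp [plusPow, mem_Ioi.1 ht, mul_comm]
  have key := integral_Ioi_mul_deriv_eq_deriv_mul (a := (0 : ℝ)) (a' := (0 : ℂ)) (b' := (0 : ℂ))
    (u := fun t => (g t : ℂ)) (u' := fun t => (g' t : ℂ))
    (v := fun t => (t : ℂ) ^ (s + 1) / (s + 1)) (v' := fun t => (t : ℂ) ^ s)
    (fun t _ => (hg t).ofReal_comp)
    (fun t ht => hasDerivAt_ofReal_cpow_const' (ne_of_gt ht) hsn)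
    (ei s g hs hgc hgR)
    (by
      have := (ei (s + 1) g' (by linarith) hg' hgR').div_const (s + 1)
      refine this.congr (Eventually.of_forall fun t => ?_)
      simp [mul_div_assoc])
    (by
      have hv : ContinuousAt (fun t : ℝ => (t : ℂ) ^ (s + 1)) 0 :=
        Complex.continuousAt_ofReal_cpow_const _ _ (Or.inl hs1)
      have h1 : ContinuousAt ((fun t : ℝ => (g t : ℂ)) *
          fun t : ℝ => (t : ℂ) ^ (s + 1) / (s + 1)) 0 :=
        (Complex.continuous_ofReal.comp hgc).continuousAt.mul (hv.div_const _)
      have h2 := h1.tendsto.mono_left (nhdsWithin_le_nhds (s := Ioi 0))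
      simpa [Complex.zero_cpow hs0] using h2)
    (by
      refine tendsto_const_nhds.congr' ?_
      filter_upwards [eventually_gt_atTop R] with t ht
      have : g t = 0 := by
        by_contra h
        exact absurd (hgR t h) (not_le.2 (ht.trans_le (le_abs_self t)))
      simp [this])
  rw [e, e, key, sub_zero, zero_sub, ← integral_neg, ← integral_const_mul]
  congr 1; ext t
  field_simp

lemma monomialIntegral_eq_integral_integral {n : ℕ} {s : Fin (n + 1) → ℂ}
    (hs : ∀ i, -1 < (s i).re) {ψ : (Fin (n + 1) → ℝ) → ℝ} (hψ : Continuous ψ)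
    (hc : HasCompactSupport ψ) (i : Fin (n + 1)) :
    monomialIntegral s ψ = ∫ y : Fin n → ℝ, (∏ j, plusPow (y j) (s (i.succAbove j))) *
      ∫ t : ℝ, plusPow t (s i) * (ψ (i.insertNth t y) : ℂ) := by
  have hint := integrable_prod_plusPow_mul hs hψ hc
  have hmp := (volume_preserving_piFinSuccAbove (fun _ : Fin (n + 1) => ℝ) i).symm
  have hint' := (hmp.integrable_comp_emb (MeasurableEquiv.measurableEmbedding _)).2 hint
  unfold monomialIntegral
  rw [← hmp.integral_comp' (g := fun x : Fin (n + 1) → ℝ =>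
    (∏ i, plusPow (x i) (s i)) * (ψ x : ℂ))]
  rw [Measure.volume_eq_prod] at hint' ⊢
  refine (integral_prod_symm _ hint').trans ?_
  congr 1; ext y
  rw [← integral_const_mul]
  congr 1; ext t
  simp only [Function.comp, MeasurableEquiv.piFinSuccAbove_symm_apply, Fin.insertNthEquiv,
    Equiv.coe_fn_mk, Fin.prod_univ_succAbove _ i, Fin.insertNth_apply_same,
    Fin.insertNth_apply_succAbove]
  ring

/-- Integration by parts in the `i`-th variable. -/
lemma monomialIntegral_eq_mul_fderiv {n : ℕ} {s : Fin (n + 1) → ℂ}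
    (hs : ∀ i, -1 < (s i).re) {ψ : (Fin (n + 1) → ℝ) → ℝ} (hψ : ContDiff ℝ (⊤ : ℕ∞) ψ)
    (hc : HasCompactSupport ψ) (i : Fin (n + 1)) :
    monomialIntegral s ψ = (-(s i + 1))⁻¹ * monomialIntegral (Function.update s i (s i + 1))
      (fun x => fderiv ℝ ψ x (Pi.single i 1)) := by
  have hcd : Continuous fun x => fderiv ℝ ψ x (Pi.single i 1) :=
    (hψ.continuous_fderiv (by simp)).clm_apply continuous_const
  have hc' := hc.fderiv_apply ℝ (Pi.single i (1 : ℝ))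
  obtain ⟨R, hR1, hR⟩ := exists_abs_le_of_hasCompactSupport hc
  obtain ⟨R', hR1', hR'⟩ := exists_abs_le_of_hasCompactSupport hc'
  have hs' : ∀ j, -1 < (Function.update s i (s i + 1) j).re := by
    intro j
    rcases eq_or_ne j i with rfl | hj
    · have := hs j
      simp; linarith
    · simpa [hj] using hs j
  rw [monomialIntegral_eq_integral_integral hs hψ.continuous hc i,
    monomialIntegral_eq_integral_integral hs' hcd hc' i, ← integral_const_mul]
  congr 1; ext y
  simp only [Function.update_self, Function.update_of_ne (Fin.succAbove_ne i _)]
  have hins : ∀ t, HasDerivAt (fun t : ℝ => (i.insertNth t y : Fin (n + 1) → ℝ))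
      (Pi.single i 1) t := by
    intro t
    have : (fun t : ℝ => (i.insertNth t y : Fin (n + 1) → ℝ)) =
        Function.update (i.insertNth 0 y : Fin (n + 1) → ℝ) i :=
      funext fun t => (Fin.update_insertNth (α := fun _ => ℝ) i 0 t y).symm
    rw [this]
    exact hasDerivAt_update _ i t
  rw [integral_plusPow_mul_eq (hs i) (g := fun t => ψ (i.insertNth t y))
    (g' := fun t => fderiv ℝ ψ (i.insertNth t y) (Pi.single i 1)) (R := max R R')]
  · ring
  · intro t
    exact ((hψ.differentiable (by simp)).differentiableAt.hasFDerivAt).comp_hasDerivAt t (hins t)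
  · exact hcd.comp (continuous_iff_continuousAt.2 fun t => (hins t).continuousAt)
  · exact le_max_of_le_left (by linarith)
  · intro t ht
    simpa using (hR _ ht i).trans (le_max_left R R')
  · intro t ht
    simpa using (hR' _ ht i).trans (le_max_right R R')

/-- Integration by parts in every variable of `T`. -/
lemma exists_monomialIntegral_eq_prod_mul {n : ℕ} {ψ : (Fin (n + 1) → ℝ) → ℝ}
    (hψ : ContDiff ℝ (⊤ : ℕ∞) ψ) (hc : HasCompactSupport ψ) (T : Finset (Fin (n + 1))) :
    ∃ ψ' : (Fin (n + 1) → ℝ) → ℝ, ContDiff ℝ (⊤ : ℕ∞) ψ' ∧ HasCompactSupport ψ' ∧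
      ∀ s : Fin (n + 1) → ℂ, (∀ i, -1 < (s i).re) → monomialIntegral s ψ =
        (∏ i ∈ T, (-(s i + 1))⁻¹) *
          monomialIntegral (fun i => if i ∈ T then s i + 1 else s i) ψ' := by
  induction T using Finset.induction_on with
  | empty => exact ⟨ψ, hψ, hc, by simp⟩
  | insert a T ha ih =>
    obtain ⟨ψ', hψ', hc', h⟩ := ih
    refine ⟨fun x => fderiv ℝ ψ' x (Pi.single a 1),
      (hψ'.fderiv_right (m := (⊤ : ℕ∞)) (by simp)).clm_apply contDiff_const,
      hc'.fderiv_apply ℝ _, fun s hs => ?_⟩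
    rw [h s hs, monomialIntegral_eq_mul_fderiv _ hψ' hc' a, Finset.prod_insert ha]
    · simp only [ha, if_false]
      have : Function.update (fun i => if i ∈ T then s i + 1 else s i) a (s a + 1) =
          fun i => if i ∈ insert a T then s i + 1 else s i := by
        ext j
        rcases eq_or_ne j a with rfl | hj
        · simp
        · simp [hj]
      rw [this]; ring
    · intro i
      have := hs i
      split_ifs
      · simp; linarith
      · exact this

lemma isOpen_forall_lt_mul_re {n : ℕ} (l m : Fin n → ℝ) :
    IsOpen {z : ℂ | ∀ i, 0 < l i * z.re + m i} := by
  simp only [ofPred_forall]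
  exact isOpen_iInter_of_finite fun i => isOpen_lt (by fun_prop) (by fun_prop)

lemma differentiableAt_monomialIntegral {n : ℕ} (l m : Fin n → ℝ) (hl : ∀ i, 0 < l i)
    {ψ : (Fin n → ℝ) → ℝ} (hψ : Continuous ψ) (hc : HasCompactSupport ψ) {z₀ : ℂ}
    (hz : ∀ i, 0 < l i * z₀.re + m i) :
    DifferentiableAt ℂ (fun z : ℂ => monomialIntegral (fun i => l i * z + m i) ψ) z₀ := by
  obtain ⟨R, hR1, hR⟩ := exists_abs_le_of_hasCompactSupport hc
  obtain ⟨ε, hε, hball⟩ := Metric.isOpen_iff.1 (isOpen_forall_lt_mul_re l m) z₀ hz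
  have hre : ∀ z : ℂ, ∀ i, ((l i : ℂ) * z + m i).re = l i * z.re + m i := by simp
  have hbd : ∀ z ∈ Metric.ball z₀ ε, ∀ x, ‖(∏ i, plusPow (x i) (l i * z + m i)) * (ψ x : ℂ)‖ ≤
      (∏ i, R ^ (l i * (z₀.re + ε) + m i)) * |ψ x| := by
    intro z hz x
    by_cases hx : ψ x = 0
    · simp [hx]
    rw [norm_mul, norm_prod, Complex.norm_real, Real.norm_eq_abs]
    refine mul_le_mul_of_nonneg_right (Finset.prod_le_prod (fun _ _ => norm_nonneg _) fun i _ => ?_)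
      (abs_nonneg _)
    refine norm_plusPow_le hR1 ((le_abs_self _).trans (hR x hx i)) ?_ ?_
    · rw [hre]; exact (hball hz i).le
    · rw [hre]
      have h1 : z.re - z₀.re ≤ ε := by
        rw [← Complex.sub_re]
        exact (Complex.re_le_norm _).trans (by simpa [dist_eq_norm] using (Metric.mem_ball.1 hz).le)
      have := mul_le_mul_of_nonneg_left (sub_le_iff_le_add'.1 h1) (hl i).le
      linarith
  have hderiv : ∀ z x, HasDerivAt
      (fun z : ℂ => (∏ i, plusPow (x i) (l i * z + m i)) * (ψ x : ℂ))
      ((∑ i, (l i : ℂ) * Real.log (x i)) * (∏ i, plusPow (x i) (l i * z + m i)) * (ψ x : ℂ)) z :=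
    fun z x => (hasDerivAt_prod_plusPow x l m Finset.univ z).mul_const _
  have hψm : Measurable fun x => (ψ x : ℂ) := (Complex.continuous_ofReal.comp hψ).measurable
  refine (hasDerivAt_integral_of_dominated_loc_of_deriv_le
    (F := fun (z : ℂ) (x : Fin n → ℝ) => (∏ i, plusPow (x i) (l i * z + m i)) * (ψ x : ℂ))
    (F' := fun (z : ℂ) (x : Fin n → ℝ) =>
      (∑ i, (l i : ℂ) * Real.log (x i)) * (∏ i, plusPow (x i) (l i * z + m i)) * (ψ x : ℂ))
    (bound := fun x => (∏ i, R ^ (l i * (z₀.re + ε) + m i)) * |ψ x| / (ε / 2))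
    (Metric.ball_mem_nhds z₀ (half_pos hε)) ?_ ?_ ?_ ?_ ?_ ?_).2.differentiableAt
  · exact Eventually.of_forall fun z =>
      ((measurable_prod_plusPow _).mul hψm).aestronglyMeasurable
  · refine integrable_prod_plusPow_mul (fun i => ?_) hψ hc
    rw [hre]; linarith [hz i]
  · refine Measurable.aestronglyMeasurable ?_
    refine (Measurable.mul ?_ (measurable_prod_plusPow _)).mul hψm
    fun_prop
  · refine Eventually.of_forall fun x z hz => ?_
    rw [← (hderiv z x).deriv]
    refine Complex.norm_deriv_le_of_forall_mem_sphere_norm_le (half_pos hε) ?_ ?_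
    · exact Differentiable.diffContOnCl fun w => (hderiv w x).differentiableAt
    · intro w hw
      refine hbd w ?_ x
      rw [Metric.mem_ball] at hz ⊢
      rw [mem_sphere_iff_norm, ← dist_eq_norm] at hw
      linarith [dist_triangle w z z₀]
  · exact (((hψ.integrable_of_hasCompactSupport hc).abs.const_mul _).div_const _)
  · exact Eventually.of_forall fun x z _ => hderiv z x

/-- The expression for the continuation of `monomialIntegral` obtained from `N` integrations by
parts in every variable, where `ψ N` is the differentiated test function. -/
noncomputable def continuationStep {n : ℕ} (l m : Fin n → ℝ) (ψ : ℕ → (Fin n → ℝ) → ℝ) (N : ℕ)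
    (z : ℂ) : ℂ :=
  (∏ i, ∏ r ∈ Finset.range N, (-((l i : ℂ) * z + (m i + r + 1 : ℝ)))⁻¹) *
    monomialIntegral (fun i => (l i : ℂ) * z + (m i + N : ℝ)) (ψ N)

/-- Smooth compactly supported `ψ N` starting from `φ`, each obtained from the previous one by
differentiating once in every variable, up to the resulting integral identity. -/
lemma exists_iterated_mixed_derivs {n : ℕ} {φ : (Fin (n + 1) → ℝ) → ℝ}
    (hφ : ContDiff ℝ (⊤ : ℕ∞) φ) (hc : HasCompactSupport φ) :
    ∃ ψ : ℕ → (Fin (n + 1) → ℝ) → ℝ, ψ 0 = φ ∧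
      (∀ N, ContDiff ℝ (⊤ : ℕ∞) (ψ N) ∧ HasCompactSupport (ψ N)) ∧
      ∀ N (s : Fin (n + 1) → ℂ), (∀ i, -1 < (s i).re) → monomialIntegral s (ψ N) =
        (∏ i, (-(s i + 1))⁻¹) * monomialIntegral (fun i => s i + 1) (ψ (N + 1)) := by
  have step : ∀ f : {f : (Fin (n + 1) → ℝ) → ℝ // ContDiff ℝ (⊤ : ℕ∞) f ∧ HasCompactSupport f},
      ∃ g : {f : (Fin (n + 1) → ℝ) → ℝ // ContDiff ℝ (⊤ : ℕ∞) f ∧ HasCompactSupport f},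
      ∀ s : Fin (n + 1) → ℂ, (∀ i, -1 < (s i).re) → monomialIntegral s f.1 =
        (∏ i, (-(s i + 1))⁻¹) * monomialIntegral (fun i => s i + 1) g.1 := by
    rintro ⟨f, hf, hfc⟩
    obtain ⟨g, hg, hgc, h⟩ := exists_monomialIntegral_eq_prod_mul hf hfc Finset.univ
    exact ⟨⟨g, hg, hgc⟩, by simpa using h⟩
  choose D hD using step
  refine ⟨fun N => (D^[N] ⟨φ, hφ, hc⟩).1, rfl, fun N => (D^[N] ⟨φ, hφ, hc⟩).2, fun N s hs => ?_⟩
  simp only [Function.iterate_succ_apply']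
  exact hD _ s hs

lemma continuationStep_succ {n : ℕ} (l m : Fin n → ℝ) {ψ : ℕ → (Fin n → ℝ) → ℝ}
    (h : ∀ N (s : Fin n → ℂ), (∀ i, -1 < (s i).re) → monomialIntegral s (ψ N) =
        (∏ i, (-(s i + 1))⁻¹) * monomialIntegral (fun i => s i + 1) (ψ (N + 1)))
    {N : ℕ} {z : ℂ} (hz : ∀ i, -1 < l i * z.re + m i + N) :
    continuationStep l m ψ (N + 1) z = continuationStep l m ψ N z := by
  unfold continuationStep
  rw [h N (fun i => (l i : ℂ) * z + (m i + N : ℝ)) (fun i => by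
    have := hz i
    simp; linarith), ← mul_assoc, ← Finset.prod_mul_distrib]
  congr 1
  · refine Finset.prod_congr rfl fun i _ => ?_
    rw [Finset.prod_range_succ]
    push_cast
    ring_nf
  · congr 1
    ext i
    push_cast
    ring

lemma continuationStep_eq_of_le {n : ℕ} (l m : Fin n → ℝ) {ψ : ℕ → (Fin n → ℝ) → ℝ}
    (h : ∀ N (s : Fin n → ℂ), (∀ i, -1 < (s i).re) → monomialIntegral s (ψ N) =
        (∏ i, (-(s i + 1))⁻¹) * monomialIntegral (fun i => s i + 1) (ψ (N + 1)))
    {N M : ℕ} (hNM : N ≤ M) {z : ℂ} (hz : ∀ i, -1 < l i * z.re + m i + N) :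
    continuationStep l m ψ M z = continuationStep l m ψ N z := by
  induction M, hNM using Nat.le_induction with
  | base => rfl
  | succ M hM ih =>
    rw [continuationStep_succ l m h, ih]
    intro i
    have : (N : ℝ) ≤ M := by exact_mod_cast hM
    linarith [hz i]

lemma exists_nat_forall_pos {n : ℕ} (l m : Fin n → ℝ) (x : ℝ) :
    ∃ N : ℕ, ∀ i, 0 < l i * x + m i + N := by
  have : ∀ᶠ N : ℕ in atTop, ∀ i, 0 < l i * x + m i + N := by
    rw [eventually_all]
    intro i
    filter_upwards [tendsto_natCast_atTop_atTop.eventually_gt_atTop (-(l i * x + m i))] with N hN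
    linarith
  exact this.exists

/-- The functions `continuationStep` glue to a single function. -/
lemma exists_continuation {n : ℕ} (l m : Fin n → ℝ) {ψ : ℕ → (Fin n → ℝ) → ℝ}
    (h : ∀ N (s : Fin n → ℂ), (∀ i, -1 < (s i).re) → monomialIntegral s (ψ N) =
        (∏ i, (-(s i + 1))⁻¹) * monomialIntegral (fun i => s i + 1) (ψ (N + 1))) :
    ∃ F : ℂ → ℂ, ∀ (N : ℕ) (z : ℂ), (∀ i, -1 < l i * z.re + m i + N) → F z = continuationStep l m ψ N z := by
  choose K hK using fun z : ℂ => exists_nat_forall_pos l m z.re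
  refine ⟨fun z => continuationStep l m ψ (K z) z, fun N z hz => ?_⟩
  have hK' : ∀ i, -1 < l i * z.re + m i + K z := fun i => by linarith [hK z i]
  rcases le_total N (K z) with hle | hle
  · exact continuationStep_eq_of_le l m h hle hz
  · exact (continuationStep_eq_of_le l m h hle hK').symm

lemma analyticAt_monomialIntegral {n : ℕ} (l m : Fin n → ℝ) (hl : ∀ i, 0 < l i)
    {ψ : (Fin n → ℝ) → ℝ} (hψ : Continuous ψ) (hc : HasCompactSupport ψ) {z₀ : ℂ}
    (hz : ∀ i, 0 < l i * z₀.re + m i) :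
    AnalyticAt ℂ (fun z : ℂ => monomialIntegral (fun i => (l i : ℂ) * z + m i) ψ) z₀ := by
  refine DifferentiableOn.analyticAt (s := {z : ℂ | ∀ i, 0 < l i * z.re + m i})
    (fun z hz' => ?_) ((isOpen_forall_lt_mul_re l m).mem_nhds hz)
  exact (differentiableAt_monomialIntegral l m hl hψ hc hz').differentiableWithinAt

lemma tendsto_mul_prod_inv {a b μ : ℝ} (ha : 0 < a) (N : ℕ)
    [Decidable (∃ r : ℕ, 0 < r ∧ (b + r) / a = μ)] :
    ∃ c : ℂ, Tendsto (fun z : ℂ => (if ∃ r : ℕ, 0 < r ∧ (b + r) / a = μ then z + μ else 1) *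
      ∏ r ∈ Finset.range N, (-((a : ℂ) * z + (b + r + 1 : ℝ)))⁻¹) (𝓝[≠] (-(μ : ℂ))) (𝓝 c) := by
  have hfac : ∀ r : ℕ, (b + (r + 1 : ℕ)) / a ≠ μ → ∃ c : ℂ,
      Tendsto (fun z : ℂ => (-((a : ℂ) * z + (b + r + 1 : ℝ)))⁻¹) (𝓝[≠] (-(μ : ℂ))) (𝓝 c) := by
    intro r hr
    refine ⟨_, (ContinuousAt.inv₀ (by fun_prop) ?_).tendsto.mono_left nhdsWithin_le_nhds⟩
    intro h0
    apply hr
    rw [div_eq_iff ha.ne']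
    have h1 : ((a * -μ + (b + r + 1) : ℝ) : ℂ) = 0 := by
      push_cast at h0 ⊢
      linear_combination -h0
    have h2 : a * -μ + (b + r + 1) = 0 := by exact_mod_cast h1
    push_cast
    linarith
  have hlin : Tendsto (fun z : ℂ => z + μ) (𝓝[≠] (-(μ : ℂ))) (𝓝 (-(μ : ℂ) + μ)) :=
    (Continuous.tendsto (by fun_prop) _).mono_left nhdsWithin_le_nhds
  have hprod : ∀ T : Finset ℕ, (∀ r ∈ T, (b + (r + 1 : ℕ)) / a ≠ μ) → ∃ c : ℂ,
      Tendsto (fun z : ℂ => ∏ r ∈ T, (-((a : ℂ) * z + (b + r + 1 : ℝ)))⁻¹)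
        (𝓝[≠] (-(μ : ℂ))) (𝓝 c) := by
    intro T hT
    choose! c hc using hfac
    exact ⟨∏ r ∈ T, c r, tendsto_finsetProd _ fun r hr => hc r (hT r hr)⟩
  by_cases hS : ∃ r : ℕ, 0 < r ∧ (b + r) / a = μ
  · simp only [hS, if_true]
    obtain ⟨r, hr, hrμ⟩ := hS
    obtain ⟨q, rfl⟩ := Nat.exists_eq_succ_of_ne_zero hr.ne'
    have huniq : ∀ r : ℕ, (b + (r + 1 : ℕ)) / a = μ → r = q := by
      intro r hr
      rw [← hrμ, div_left_inj' ha.ne'] at hr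
      have : ((r + 1 : ℕ) : ℝ) = (q.succ : ℕ) := by linarith
      have : r + 1 = q.succ := by exact_mod_cast this
      omega
    by_cases hq : q ∈ Finset.range N
    · obtain ⟨c, hc⟩ := hprod ((Finset.range N).erase q)
        fun r hr h => (Finset.mem_erase.1 hr).1 (huniq r h)
      refine ⟨(-(a : ℂ))⁻¹ * c, (hc.const_mul _).congr' ?_⟩
      filter_upwards [self_mem_nhdsWithin] with z hz
      have hz0 : z + μ ≠ 0 := fun h => hz (eq_neg_of_add_eq_zero_left h)
      rw [← Finset.mul_prod_erase _ _ hq, ← mul_assoc]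
      congr 1
      have hb : b + q + 1 = μ * a := by
        rw [div_eq_iff ha.ne'] at hrμ
        push_cast at hrμ
        linarith
      have ha' : (a : ℂ) ≠ 0 := by exact_mod_cast ha.ne'
      have e : -((a : ℂ) * z + (b + q + 1 : ℝ)) = -a * (z + μ) := by
        rw [hb]; push_cast; ring
      rw [e, mul_inv, mul_comm, mul_assoc, inv_mul_cancel₀ hz0, mul_one]
    · obtain ⟨c, hc⟩ := hprod (Finset.range N) fun r hr h => hq (huniq r h ▸ hr)
      exact ⟨_, hlin.mul hc⟩
  · simp only [hS, if_false, one_mul]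
    exact hprod _ fun r _ h => hS ⟨r + 1, r.succ_pos, h⟩

lemma pow_kOrd_eq_prod (n : ℕ) (l m : Fin n → ℝ) (μ : ℝ) (w : ℂ) [DecidablePred fun i : Fin n =>
    ∃ r : ℕ, 0 < r ∧ (m i + (r : ℝ)) / l i = μ] :
    w ^ kOrd n l m μ = ∏ i, if ∃ r : ℕ, 0 < r ∧ (m i + (r : ℝ)) / l i = μ then w else 1 := by
  rw [Finset.prod_ite, Finset.prod_const, Finset.prod_const_one, mul_one, kOrd]
  congr 1
  rw [← Set.ncard_coe_finset]
  congr 1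
  ext i
  simp

/-- For `n ≥ 1`, `l_i > 0`, `m_i ≥ 0` and `φ` smooth compactly supported, `G(φ)`, holomorphic
for `Re λ > -min_i (m_i+1)/l_i`, extends to a meromorphic function on `ℂ` whose poles lie in
`P = ∪_i {-(m_i+r)/l_i : r ≥ 1}`, and at each `-λ_j ∈ P` the order of the pole is at most
`k_j = #S_j`. -/
theorem stmt_6 (n : ℕ) (hn : 0 < n) (l m : Fin n → ℝ)
    (hl : ∀ i, 0 < l i) (hm : ∀ i, 0 ≤ m i)
    (φ : (Fin n → ℝ) → ℝ) (hφ : ContDiff ℝ (⊤ : ℕ∞) φ) (hφc : HasCompactSupport φ) :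
    ∃ F : ℂ → ℂ,
      (∀ lam : ℂ, -(⨅ i, (m i + 1) / l i) < lam.re → F lam = Gint n l m φ lam) ∧
      (∀ lam : ℂ, (¬ ∃ t ∈ polesP n l m, lam = (t : ℂ)) → AnalyticAt ℂ F lam) ∧
      (∀ μ : ℝ, -μ ∈ polesP n l m →
        ∃ c : ℂ, Tendsto (fun lam : ℂ => (lam + (μ : ℂ)) ^ (kOrd n l m μ) * F lam)
          (𝓝[≠] (-(μ : ℂ))) (𝓝 c)) := by
  classical
  obtain ⟨k, rfl⟩ := Nat.exists_eq_succ_of_ne_zero hn.ne'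
  obtain ⟨ψ, hψ0, hψ, hstep⟩ := exists_iterated_mixed_derivs hφ hφc
  obtain ⟨F, hF⟩ := exists_continuation l m hstep
  have hFev : ∀ (N : ℕ) (z₀ : ℂ), (∀ i, 0 < l i * z₀.re + (m i + N)) →
      F =ᶠ[𝓝 z₀] continuationStep l m ψ N := by
    intro N z₀ hz₀
    filter_upwards [(isOpen_forall_lt_mul_re l fun i => m i + N).mem_nhds hz₀] with z hz
    exact hF N z fun i => by linarith [hz i]
  refine ⟨F, fun z hz => ?_, fun z hz => ?_, fun μ _ => ?_⟩
  · rw [hF 0 z fun i => ?_]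
    · simp [continuationStep, monomialIntegral, Gint, hψ0]
    · have h1 : (⨅ i, (m i + 1) / l i) ≤ (m i + 1) / l i :=
        ciInf_le (Set.finite_range _).bddBelow i
      have h2 : -((m i + 1) / l i) < z.re := by linarith
      rw [← neg_div, div_lt_iff₀ (hl i)] at h2
      simp only [Nat.cast_zero]
      linarith
  · obtain ⟨N, hN⟩ := exists_nat_forall_pos l m z.re
    have hN' : ∀ i, 0 < l i * z.re + (m i + N) := fun i => by linarith [hN i]
    refine AnalyticAt.congr ?_ (hFev N z hN').symm
    refine AnalyticAt.mul ?_ (analyticAt_monomialIntegral l (fun i => m i + N) hl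
      (hψ N).1.continuous (hψ N).2 hN')
    refine Finset.analyticAt_fun_prod _ fun i _ => Finset.analyticAt_fun_prod _ fun r _ => ?_
    refine AnalyticAt.inv (by fun_prop) fun h0 => hz ⟨_, ⟨i, r + 1, r.succ_pos, rfl⟩, ?_⟩
    have hli : (l i : ℂ) ≠ 0 := by exact_mod_cast (hl i).ne'
    push_cast at h0 ⊢
    rw [← neg_div, eq_div_iff hli]
    linear_combination -h0
  · obtain ⟨N, hN⟩ := exists_nat_forall_pos l m (-(μ : ℂ)).re
    have hN' : ∀ i, 0 < l i * (-(μ : ℂ)).re + (m i + N) := fun i => by linarith [hN i]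
    choose c hc using fun i => tendsto_mul_prod_inv (b := m i) (μ := μ) (hl i) N
    have hI := (analyticAt_monomialIntegral l (fun i => m i + N) hl
      (hψ N).1.continuous (hψ N).2 hN').continuousAt.tendsto.mono_left
        (nhdsWithin_le_nhds (s := {-(μ : ℂ)}ᶜ))
    refine ⟨_, ((tendsto_finsetProd Finset.univ fun i _ => hc i).mul hI).congr' ?_⟩
    filter_upwards [(hFev N _ hN').filter_mono nhdsWithin_le_nhds] with z hz
    rw [hz, continuationStep, pow_kOrd_eq_prod, Finset.prod_mul_distrib, mul_assoc]
end

section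
/- Let n ≥ 1, let l_1,…,l_n > 0 and m_1,…,m_n ≥ 0 be real numbers, and let φ : ℝ^n → ℝ be a smooth compactly supported function. Let -λ_j ∈ P be a candidate pole of the meromorphic extension of H(φ) and let 1 ≤ k ≤ k_j. Assume that for every subset S ⊆ S_j with #S = k there exists i ∈ S such that ν_i is odd. Then the Laurent coefficients of H(φ) at λ = -λ_j satisfy b_{j,k} = b_{j,k+1} = ⋯ = b_{j,k_j} = 0. -/
open MeasureTheory Filter Set
open scoped Topology

/-- `|x|^s`: equals `exp(s log |x|)` for `x ≠ 0` and `0` for `x = 0`. -/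
noncomputable def absPow (x : ℝ) (s : ℂ) : ℂ := if x = 0 then 0 else ((|x| : ℝ) : ℂ) ^ s

/-- `H(φ)(λ) = ∫_{ℝⁿ} |x₁|^(l₁λ+m₁) ⋯ |x_n|^(l_nλ+m_n) φ(x) dx`. -/
noncomputable def Hint (n : ℕ) (l m : Fin n → ℝ) (φ : (Fin n → ℝ) → ℝ) (lam : ℂ) : ℂ :=
  ∫ x : Fin n → ℝ, (∏ i, absPow (x i) ((l i : ℂ) * lam + (m i : ℂ))) * (φ x : ℂ)

lemma hasFDerivAt_intervalIntegral_of_contDiff {E F : Type*} [NormedAddCommGroup E]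
    [NormedSpace ℝ E] [ProperSpace E] [NormedAddCommGroup F] [NormedSpace ℝ F]
    {f : E × ℝ → F} (hf : ContDiff ℝ 1 f) (x : E) :
    HasFDerivAt (fun x => ∫ t in (0 : ℝ)..1, f (x, t))
      (∫ t in (0 : ℝ)..1, (fderiv ℝ f (x, t)).comp (ContinuousLinearMap.inl ℝ E ℝ)) x := by
  have hc := hf.continuous
  have hd : Continuous (fderiv ℝ f) := hf.continuous_fderiv one_ne_zero
  have hd' : Continuous (fun p : E × ℝ => (fderiv ℝ f p).comp (ContinuousLinearMap.inl ℝ E ℝ)) := by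
    fun_prop
  obtain ⟨C, hC⟩ := ((isCompact_closedBall x 1).prod
    (isCompact_Icc (a := (0 : ℝ)) (b := 1))).exists_bound_of_continuousOn hd'.continuousOn
  refine intervalIntegral.hasFDerivAt_integral_of_dominated_of_fderiv_le
    (F' := fun x t => (fderiv ℝ f (x, t)).comp (ContinuousLinearMap.inl ℝ E ℝ))
    (bound := fun _ => C) (s := Metric.closedBall x 1)
    (Metric.closedBall_mem_nhds x one_pos) ?_ ?_ ?_ ?_ ?_ ?_
  · exact Eventually.of_forall fun y =>
      (by fun_prop : Continuous fun t => f (y, t)).aestronglyMeasurable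
  · exact (by fun_prop : Continuous fun t => f (x, t)).intervalIntegrable _ _
  · exact (by fun_prop : Continuous fun t : ℝ =>
      (fderiv ℝ f (x, t)).comp (ContinuousLinearMap.inl ℝ E ℝ)).aestronglyMeasurable
  · refine Eventually.of_forall fun t ht y hy => hC (y, t) ⟨hy, ?_⟩
    rw [uIoc_of_le zero_le_one] at ht
    exact ⟨ht.1.le, ht.2⟩
  · exact intervalIntegrable_const
  · refine Eventually.of_forall fun t _ y _ => ?_
    exact ((hf.differentiable one_ne_zero) (y, t)).hasFDerivAt.comp y (hasFDerivAt_prodMk_left y t)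

lemma contDiff_nat_intervalIntegral {E F : Type} [NormedAddCommGroup E] [NormedSpace ℝ E]
    [ProperSpace E] [NormedAddCommGroup F] [NormedSpace ℝ F] (N : ℕ)
    {f : E × ℝ → F} (hf : ContDiff ℝ N f) :
    ContDiff ℝ N (fun x => ∫ t in (0 : ℝ)..1, f (x, t)) := by
  induction N generalizing F with
  | zero =>
    rw [Nat.cast_zero, contDiff_zero] at hf ⊢
    exact intervalIntegral.continuous_parametric_intervalIntegral_of_continuous'
      (f := fun x t => f (x, t)) hf 0 1
  | succ N ih =>
    have h1 : ContDiff ℝ 1 f := hf.of_le (by exact_mod_cast Nat.le_add_left 1 N)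
    rw [Nat.cast_add, Nat.cast_one, contDiff_succ_iff_hasFDerivAt]
    refine ⟨_, ?_, hasFDerivAt_intervalIntegral_of_contDiff h1⟩
    refine ih (f := fun p => (fderiv ℝ f p).comp (ContinuousLinearMap.inl ℝ E ℝ)) ?_
    exact (hf.fderiv_right (by norm_cast)).clm_comp contDiff_const

/-- Integrating a smooth function over a parameter in `[0, 1]` gives a smooth function. -/
lemma contDiff_intervalIntegral {E F : Type} [NormedAddCommGroup E] [NormedSpace ℝ E]
    [ProperSpace E] [NormedAddCommGroup F] [NormedSpace ℝ F]
    {f : E × ℝ → F} (hf : ContDiff ℝ (⊤ : ℕ∞) f) :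
    ContDiff ℝ (⊤ : ℕ∞) (fun x => ∫ t in (0 : ℝ)..1, f (x, t)) :=
  contDiff_infty.2 fun N => contDiff_nat_intervalIntegral N (contDiff_infty.1 hf N)

/-- A parameter integral of functions holomorphic in the parameter is holomorphic. -/
lemma differentiableOn_integral_of_continuousOn {X : Type*} [TopologicalSpace X]
    [MeasurableSpace X] [OpensMeasurableSpace X] [SecondCountableTopology X] [T2Space X]
    {ρ : Measure X} [IsFiniteMeasureOnCompacts ρ] {U : Set ℂ} (hU : IsOpen U)
    {f : ℂ → X → ℂ} (hf : ContinuousOn (Function.uncurry f) (U ×ˢ univ))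
    (hd : ∀ x, DifferentiableOn ℂ (fun z => f z x) U) {K : Set X} (hK : IsCompact K)
    (hfK : ∀ z, ∀ x ∉ K, f z x = 0) :
    DifferentiableOn ℂ (fun z => ∫ x, f z x ∂ρ) U := by
  intro z₀ hz₀
  obtain ⟨R, hR, hRU⟩ := Metric.nhds_basis_closedBall.mem_iff.1 (hU.mem_nhds hz₀)
  set r := R / 2 with hr
  have hr0 : 0 < r := by positivity
  obtain ⟨C, hC⟩ := ((isCompact_closedBall z₀ R).prod hK).exists_bound_of_continuousOn
    (hf.mono (prod_mono hRU (subset_univ _)))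
  have hcont : ∀ z ∈ U, Continuous (f z) := fun z hz => by
    rw [← continuousOn_univ]
    exact hf.comp (f := fun x => (z, x)) (by fun_prop) fun x _ => ⟨hz, mem_univ _⟩
  have hder : ∀ x, ∀ z ∈ U, HasDerivAt (fun z => f z x) (deriv (fun z => f z x) z) z :=
    fun x z hz => ((hd x).differentiableAt (hU.mem_nhds hz)).hasDerivAt
  have hball : Metric.ball z₀ r ⊆ U := fun z hz =>
    hRU (Metric.closedBall_subset_closedBall (by linarith) (Metric.ball_subset_closedBall hz))
  refine (hasDerivAt_integral_of_dominated_loc_of_deriv_le (μ := ρ) (F := f)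
    (F' := fun z x => deriv (fun z => f z x) z) (bound := K.indicator fun _ => C / r)
    (Metric.ball_mem_nhds z₀ hr0) ?_ ?_ ?_ ?_ ?_ ?_).2.differentiableAt.differentiableWithinAt
  · filter_upwards [hU.mem_nhds hz₀] with z hz using (hcont z hz).aestronglyMeasurable
  · exact (hcont z₀ hz₀).integrable_of_hasCompactSupport (HasCompactSupport.intro hK (hfK z₀))
  · have hseq : Tendsto (fun k : ℕ => z₀ + ((r / ((k : ℝ) + 1) : ℝ) : ℂ)) atTop (𝓝[≠] z₀) := by
      refine tendsto_nhdsWithin_iff.2 ⟨?_, Eventually.of_forall fun k => ?_⟩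
      · have h := (tendsto_one_div_add_atTop_nhds_zero_nat (𝕜 := ℝ)).const_mul r
        have h' := (Complex.continuous_ofReal.tendsto _).comp h
        have h'' := h'.const_add z₀
        simpa [Function.comp_def, div_eq_mul_inv] using h''
      · have : r / ((k : ℝ) + 1) ≠ 0 := by positivity
        simpa using (by exact_mod_cast this : ((r / ((k : ℝ) + 1) : ℝ) : ℂ) ≠ 0)
    refine aestronglyMeasurable_of_tendsto_ae atTop
      (f := fun (k : ℕ) x => slope (fun z => f z x) z₀ (z₀ + ((r / ((k : ℝ) + 1) : ℝ) : ℂ)))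
      (fun k => ?_) (Eventually.of_forall fun x => ?_)
    · have hk : z₀ + ((r / ((k : ℝ) + 1) : ℝ) : ℂ) ∈ U := by
        refine hRU ?_
        rw [Metric.mem_closedBall, dist_eq_norm, add_sub_cancel_left, Complex.norm_real,
          Real.norm_of_nonneg (by positivity)]
        have : r / ((k : ℝ) + 1) ≤ r := div_le_self hr0.le (by linarith [k.cast_nonneg (α := ℝ)])
        linarith
      have h1 := hcont _ hk
      have h2 := hcont _ hz₀
      simp only [slope, vsub_eq_sub]
      exact (by fun_prop : Continuous _).aestronglyMeasurable
    · exact ((hder x z₀ hz₀).tendsto_slope).comp hseq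
  · refine Eventually.of_forall fun x z hz => ?_
    by_cases hx : x ∈ K
    · rw [indicator_of_mem hx]
      have hsub : Metric.closedBall z r ⊆ Metric.closedBall z₀ R :=
        Metric.closedBall_subset_closedBall' (by rw [Metric.mem_ball] at hz; linarith)
      refine Complex.norm_deriv_le_of_forall_mem_sphere_norm_le hr0 ?_ fun w hw => ?_
      · exact ((hd x).mono (hsub.trans hRU)).diffContOnCl_ball (le_refl _)
      · exact hC (w, x) ⟨hsub (Metric.sphere_subset_closedBall hw), hx⟩
    · simp [indicator_of_notMem hx, hfK _ x hx]
  · exact (integrable_indicator_iff hK.measurableSet).2 (integrableOn_const hK.measure_ne_top)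
  · exact Eventually.of_forall fun x z hz => hder x z (hball hz)

lemma absPow_of_ne_zero {s : ℂ} (hs : s ≠ 0) (x : ℝ) : absPow x s = ((|x| : ℝ) : ℂ) ^ s := by
  unfold absPow
  split_ifs with h
  · simp [h, Complex.zero_cpow hs]
  · rfl

lemma absPow_neg (x : ℝ) (s : ℂ) : absPow (-x) s = absPow x s := by
  simp [absPow]

lemma ne_zero_of_re_pos {s : ℂ} (hs : 0 < s.re) : s ≠ 0 := by
  rintro rfl
  simp at hs

lemma absPow_add_two {s : ℂ} (x : ℝ) : absPow x (s + 2) = absPow x s * (x : ℂ) ^ 2 := by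
  by_cases h : x = 0
  · simp [absPow, h]
  · have hx : ((|x| : ℝ) : ℂ) ≠ 0 := by simpa using h
    rw [absPow, absPow, if_neg h, if_neg h, Complex.cpow_add _ _ hx, Complex.cpow_ofNat]
    congr 1
    exact_mod_cast sq_abs x

lemma continuousAt_absPow {p : ℝ × ℂ} (hp : 0 < p.2.re) :
    ContinuousAt (fun p : ℝ × ℂ => absPow p.1 p.2) p := by
  have h : (fun q : ℝ × ℂ => ((|q.1| : ℝ) : ℂ) ^ q.2) =ᶠ[𝓝 p] fun q => absPow q.1 q.2 := by
    have ho : IsOpen {q : ℝ × ℂ | 0 < q.2.re} :=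
      isOpen_lt continuous_const (Complex.continuous_re.comp continuous_snd)
    filter_upwards [ho.mem_nhds hp] with q hq
    rw [absPow_of_ne_zero (ne_zero_of_re_pos hq)]
  refine ContinuousAt.congr ?_ h
  exact (Complex.continuousAt_ofReal_cpow |p.1| p.2 (Or.inl hp)).comp
    (f := fun q : ℝ × ℂ => (|q.1|, q.2)) (by fun_prop)

lemma hasDerivAt_absPow_mul_self {s : ℂ} (hs : 0 < s.re) (x : ℝ) :
    HasDerivAt (fun y : ℝ => absPow y s * (y : ℂ)) ((s + 1) * absPow x s) x := by
  have hs1 : s + 1 ≠ 0 := ne_zero_of_re_pos (by simp; linarith)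
  have hpos : ∀ y : ℝ, 0 < y →
      HasDerivAt (fun y : ℝ => absPow y s * (y : ℂ)) ((s + 1) * absPow y s) y := by
    intro y hy
    have h := hasDerivAt_ofReal_cpow_const hy.ne' hs1
    have he : (fun y : ℝ => (y : ℂ) ^ (s + 1)) =ᶠ[𝓝 y] fun y : ℝ => absPow y s * (y : ℂ) := by
      filter_upwards [lt_mem_nhds hy] with z hz
      have hz0 : (z : ℂ) ≠ 0 := by exact_mod_cast hz.ne'
      rw [absPow, if_neg hz.ne', abs_of_pos hz, Complex.cpow_add _ _ hz0, Complex.cpow_one]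
    rw [absPow, if_neg hy.ne', abs_of_pos hy]
    rw [add_sub_cancel_right] at h
    exact h.congr_of_eventuallyEq he.symm
  rcases lt_trichotomy x 0 with hx | rfl | hx
  · have h := (hpos (-x) (by linarith)).scomp x (hasDerivAt_neg x)
    have h' := h.neg
    simp only [absPow_neg, Function.comp_def, neg_smul, one_smul, neg_neg] at h'
    refine h'.congr_of_eventuallyEq (Eventually.of_forall fun y => ?_)
    simp
  · rw [hasDerivAt_iff_tendsto_slope]
    have h0 : absPow 0 s = 0 := by simp [absPow]
    have hc : ContinuousAt (fun y : ℝ => absPow y s) 0 :=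
      (continuousAt_absPow (p := (0, s)) hs).comp (f := fun y : ℝ => (y, s)) (by fun_prop)
    have ht := hc.tendsto.mono_left (nhdsWithin_le_nhds (s := {(0 : ℝ)}ᶜ))
    rw [h0] at ht
    rw [h0, mul_zero]
    refine ht.congr' ?_
    filter_upwards [self_mem_nhdsWithin] with y hy
    have hy0 : (y : ℂ) ≠ 0 := by exact_mod_cast hy
    simp [slope, h0]
    field_simp
  · exact hpos x hx

/-- The monomial `|x₁|^s₁ ⋯ |x_n|^s_n`. -/
noncomputable def absMonomial {n : ℕ} (s : Fin n → ℂ) (x : Fin n → ℝ) : ℂ :=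
  ∏ i, absPow (x i) (s i)

/-- The integral of a function against `|x₁|^s₁ ⋯ |x_n|^s_n`. -/
noncomputable def absMoment {n : ℕ} (s : Fin n → ℂ) (φ : (Fin n → ℝ) → ℝ) : ℂ :=
  ∫ x, absMonomial s x * (φ x : ℂ)

/-- The reflection of `ℝⁿ` changing the sign of the `i`-th coordinate. -/
noncomputable def reflect {n : ℕ} (i : Fin n) : (Fin n → ℝ) →L[ℝ] (Fin n → ℝ) :=
  ContinuousLinearMap.id ℝ _ -
    ((2 : ℝ) • ContinuousLinearMap.proj (R := ℝ) (φ := fun _ : Fin n => ℝ) i).smulRight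
      (Pi.single i (1 : ℝ))

section

variable {n : ℕ}

lemma reflect_eq (i : Fin n) (x : Fin n → ℝ) :
    reflect i x = x - (2 * x i) • Pi.single i (1 : ℝ) := by
  simp [reflect]

lemma reflect_apply (i j : Fin n) (x : Fin n → ℝ) :
    reflect i x j = if j = i then -x j else x j := by
  rw [reflect_eq]
  split_ifs with h
  · subst h; simp; ring
  · simp [h]

lemma reflect_reflect (i : Fin n) (x : Fin n → ℝ) : reflect i (reflect i x) = x := by
  ext j
  simp only [reflect_apply]
  split_ifs <;> simp

lemma measurePreserving_reflect (i : Fin n) : MeasurePreserving (reflect i) := by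
  have h := volume_preserving_pi (α' := fun _ : Fin n => ℝ) (β' := fun _ : Fin n => ℝ)
    (f := fun j y => if j = i then -y else y) (fun j => by
      by_cases hj : j = i
      · simpa [hj] using Measure.measurePreserving_neg (volume : Measure ℝ)
      · simp only [hj, if_false]
        exact MeasurePreserving.id (volume : Measure ℝ))
  convert! h using 1
  ext x j
  simp [reflect_apply]

lemma absMonomial_reflect (i : Fin n) (s : Fin n → ℂ) (x : Fin n → ℝ) :
    absMonomial s (reflect i x) = absMonomial s x := by
  unfold absMonomial
  refine Finset.prod_congr rfl fun j _ => ?_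
  rw [reflect_apply]
  split_ifs
  · rw [absPow_neg]
  · rfl

lemma continuous_absMonomial {s : Fin n → ℂ} (hs : ∀ i, 0 < (s i).re) :
    Continuous (absMonomial s) := by
  refine continuous_finsetProd _ fun i _ => continuous_iff_continuousAt.2 fun x => ?_
  exact (continuousAt_absPow (p := (x i, s i)) (hs i)).comp
    (f := fun x : Fin n → ℝ => (x i, s i)) (by fun_prop : Continuous _).continuousAt

lemma integrable_mul_ofReal {f : (Fin n → ℝ) → ℂ} (hf : Continuous f) {φ : (Fin n → ℝ) → ℝ}
    (hφ : Continuous φ) (hφc : HasCompactSupport φ) :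
    Integrable (fun x => f x * (φ x : ℂ)) := by
  refine (by fun_prop : Continuous fun x => f x * (φ x : ℂ)).integrable_of_hasCompactSupport ?_
  exact HasCompactSupport.intro hφc fun x hx => by simp [image_eq_zero_of_notMem_tsupport hx]

/-- Averaging over a reflection makes a test function even without changing its moments. -/
lemma exists_even_absMoment_eq (i : Fin n) {φ : (Fin n → ℝ) → ℝ} (hφ : ContDiff ℝ (⊤ : ℕ∞) φ)
    (hφc : HasCompactSupport φ) :
    ∃ ψ : (Fin n → ℝ) → ℝ, ContDiff ℝ (⊤ : ℕ∞) ψ ∧ HasCompactSupport ψ ∧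
      (∀ x, ψ (reflect i x) = ψ x) ∧
      ∀ s : Fin n → ℂ, (∀ j, 0 < (s j).re) → absMoment s ψ = absMoment s φ := by
  have hR : ContDiff ℝ (⊤ : ℕ∞) fun x => φ (reflect i x) := hφ.comp (reflect i).contDiff
  have hemb : Topology.IsClosedEmbedding (reflect i) :=
    (Homeomorph.mk ⟨reflect i, reflect i, reflect_reflect i, reflect_reflect i⟩
      (reflect i).continuous (reflect i).continuous).isClosedEmbedding
  have hRc : HasCompactSupport fun x => φ (reflect i x) := hφc.comp_isClosedEmbedding hemb
  refine ⟨fun x => (1 / 2) * (φ x + φ (reflect i x)), contDiff_const.mul (hφ.add hR), ?_, ?_, ?_⟩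
  · exact (hφc.add hRc).mul_left
  · intro x
    simp only [reflect_reflect]
    ring
  · intro s hs
    have hc := continuous_absMonomial hs
    have h1 := integrable_mul_ofReal hc hφ.continuous hφc
    have h2 := integrable_mul_ofReal hc hR.continuous hRc
    have h3 : ∫ x, absMonomial s x * ((φ (reflect i x) : ℝ) : ℂ) = absMoment s φ := by
      rw [absMoment, ← (measurePreserving_reflect i).integral_comp hemb.measurableEmbedding
        fun x => absMonomial s x * (φ x : ℂ)]
      simp only [absMonomial_reflect]
    calc absMoment s (fun x => (1 / 2) * (φ x + φ (reflect i x)))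
        = ∫ x, (1 / 2 : ℂ) * (absMonomial s x * (φ x : ℂ) +
            absMonomial s x * ((φ (reflect i x) : ℝ) : ℂ)) := by
          rw [absMoment]
          congr 1
          ext x
          push_cast
          ring
      _ = absMoment s φ := by
          rw [integral_const_mul, integral_add h1 h2, h3, ← absMoment]
          ring

/-- Integration by parts in the `i`-th coordinate. -/
lemma integral_absMonomial_mul_fderiv (i : Fin n) {φ : (Fin n → ℝ) → ℝ} (hφ : ContDiff ℝ 1 φ)
    (hφc : HasCompactSupport φ) {s : Fin n → ℂ} (hs : ∀ j, 0 < (s j).re) :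
    ∫ x, absMonomial s x * (x i : ℂ) * ((fderiv ℝ φ x (Pi.single i 1) : ℝ) : ℂ) =
      -((s i + 1) * absMoment s φ) := by
  have hc := continuous_absMonomial hs
  have hd : Continuous fun x => fderiv ℝ φ x (Pi.single i 1) :=
    (hφ.continuous_fderiv one_ne_zero).clm_apply continuous_const
  have hdc : HasCompactSupport fun x => fderiv ℝ φ x (Pi.single i 1) :=
    hφc.fderiv_apply ℝ _
  have h := integral_bilinear_hasLineDerivAt_right_eq_neg_left_of_integrable
    (μ := (volume : Measure (Fin n → ℝ))) (v := Pi.single i (1 : ℝ))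
    (f := fun x : Fin n → ℝ => absMonomial s x * (x i : ℂ))
    (f' := fun x => (s i + 1) * absMonomial s x)
    (g := fun x => ((φ x : ℝ) : ℂ)) (g' := fun x => ((fderiv ℝ φ x (Pi.single i 1) : ℝ) : ℂ))
    (B := ContinuousLinearMap.mul ℝ ℂ) ?_ ?_ ?_ ?_ ?_
  · simp only [ContinuousLinearMap.mul_apply'] at h
    rw [h, absMoment, ← integral_const_mul]
    simp only [mul_assoc]
  · exact integrable_mul_ofReal (by fun_prop) hφ.continuous hφc
  · exact integrable_mul_ofReal (by fun_prop) hd hdc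
  · exact integrable_mul_ofReal (by fun_prop) hφ.continuous hφc
  · intro x _
    have key := hasDerivAt_absPow_mul_self (hs i) (x i + 0)
    have hshift : HasDerivAt (fun t : ℝ => x i + t) 1 0 := (hasDerivAt_id 0).const_add (x i)
    have h1 := (key.scomp 0 hshift).mul_const (∏ j ∈ Finset.univ.erase i, absPow (x j) (s j))
    have hprod : ∀ y : Fin n → ℝ, absMonomial s y =
        absPow (y i) (s i) * ∏ j ∈ Finset.univ.erase i, absPow (y j) (s j) := fun y =>
      (Finset.mul_prod_erase _ _ (Finset.mem_univ i)).symm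
    have hline : (fun t : ℝ => absMonomial s (x + t • Pi.single i (1 : ℝ)) *
        (((x + t • Pi.single i (1 : ℝ) : Fin n → ℝ) i : ℝ) : ℂ)) = fun t : ℝ =>
          (absPow (x i + t) (s i) * ((x i + t : ℝ) : ℂ)) *
            ∏ j ∈ Finset.univ.erase i, absPow (x j) (s j) := by
      ext t
      rw [hprod]
      have : ∏ j ∈ Finset.univ.erase i, absPow ((x + t • Pi.single i (1 : ℝ) : Fin n → ℝ) j) (s j) =
          ∏ j ∈ Finset.univ.erase i, absPow (x j) (s j) :=
        Finset.prod_congr rfl fun j hj => by simp [Finset.ne_of_mem_erase hj]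
      rw [this]
      simp
      ring
    rw [HasLineDerivAt, hline]
    convert! h1 using 1
    rw [hprod]
    simp
    ring
  · intro x _
    have := ((hφ.differentiable one_ne_zero) x).hasFDerivAt.hasLineDerivAt (Pi.single i (1 : ℝ))
    exact HasDerivAt.ofReal_comp this

lemma absMonomial_update_add_two (i : Fin n) (s : Fin n → ℂ) (x : Fin n → ℝ) :
    absMonomial (Function.update s i (s i + 2)) x = absMonomial s x * (x i : ℂ) ^ 2 := by
  unfold absMonomial
  rw [← Finset.mul_prod_erase _ _ (Finset.mem_univ i),
    ← Finset.mul_prod_erase (a := i) Finset.univ (fun j => absPow (x j) (s j)) (Finset.mem_univ i),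
    Function.update_self, absPow_add_two]
  have : ∏ j ∈ Finset.univ.erase i, absPow (x j) (Function.update s i (s i + 2) j) =
      ∏ j ∈ Finset.univ.erase i, absPow (x j) (s j) :=
    Finset.prod_congr rfl fun j hj => by rw [Function.update_of_ne (Finset.ne_of_mem_erase hj)]
  rw [this]
  ring

lemma fderiv_single_reflect (i : Fin n) {f : (Fin n → ℝ) → ℝ} (hf : Differentiable ℝ f) {c : ℝ}
    (hc : ∀ x, f (reflect i x) = c * f x) (x : Fin n → ℝ) :
    fderiv ℝ f (reflect i x) (Pi.single i 1) = -(c * fderiv ℝ f x (Pi.single i 1)) := by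
  have h1 : HasFDerivAt (fun x => f (reflect i x))
      ((fderiv ℝ f (reflect i x)).comp (reflect i)) x :=
    (hf _).hasFDerivAt.comp x (reflect i).hasFDerivAt
  have h2 : HasFDerivAt (fun x => f (reflect i x)) (c • fderiv ℝ f x) x := by
    simp only [hc]
    exact (hf x).hasFDerivAt.const_mul c
  have h := congrArg (fun L => L (Pi.single i (1 : ℝ))) (h1.unique h2)
  have he : reflect i (Pi.single i (1 : ℝ)) = -Pi.single i (1 : ℝ) := by
    rw [reflect_eq, ← one_smul ℝ (-Pi.single i (1 : ℝ) : Fin n → ℝ), smul_neg, ← neg_smul]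
    nth_rewrite 1 [← one_smul ℝ (Pi.single i (1 : ℝ) : Fin n → ℝ)]
    rw [← sub_smul]
    norm_num
  simp only [ContinuousLinearMap.comp_apply, he, map_neg, smul_apply,
    smul_eq_mul] at h
  linarith

/-- For a test function `φ` even in `x_i`, the function `-(∂_i φ) / x_i` is again an even test
function. -/
lemma exists_even_fderiv_eq (i : Fin n) {φ : (Fin n → ℝ) → ℝ} (hφ : ContDiff ℝ (⊤ : ℕ∞) φ)
    (hφc : HasCompactSupport φ) (heven : ∀ x, φ (reflect i x) = φ x) :
    ∃ ψ : (Fin n → ℝ) → ℝ, ContDiff ℝ (⊤ : ℕ∞) ψ ∧ HasCompactSupport ψ ∧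
      (∀ x, ψ (reflect i x) = ψ x) ∧
      ∀ x, fderiv ℝ φ x (Pi.single i 1) = -(x i * ψ x) := by
  set e : Fin n → ℝ := Pi.single i (1 : ℝ) with he
  set D : (Fin n → ℝ) → ℝ := fun x => fderiv ℝ φ x e with hD
  have hDs : ContDiff ℝ (⊤ : ℕ∞) D := (hφ.fderiv_right le_rfl).clm_apply contDiff_const
  set D₂ : (Fin n → ℝ) → ℝ := fun x => fderiv ℝ D x e with hD₂
  have hD₂s : ContDiff ℝ (⊤ : ℕ∞) D₂ := (hDs.fderiv_right le_rfl).clm_apply contDiff_const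
  have htop : ((⊤ : ℕ∞) : WithTop ℕ∞) ≠ 0 := by simp
  have hDR : ∀ x, D (reflect i x) = -1 * D x := fun x => by
    have := fderiv_single_reflect i (hφ.differentiable htop) (c := 1) (by simpa using heven) x
    simpa [hD] using this
  have hD₂R : ∀ x, D₂ (reflect i x) = D₂ x := fun x => by
    have := fderiv_single_reflect i (hDs.differentiable htop) hDR x
    simpa [hD₂] using this
  set γ : (Fin n → ℝ) → ℝ → (Fin n → ℝ) := fun x t => x + ((t - 1) * x i) • e with hγ
  have hDc : tsupport D ⊆ tsupport φ := tsupport_fderiv_apply_subset ℝ e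
  have hD₂c : tsupport D₂ ⊆ tsupport φ := (tsupport_fderiv_apply_subset ℝ e).trans hDc
  have hmain : ∀ x, D x = x i * ∫ t in (0 : ℝ)..1, D₂ (γ x t) := fun x => by
    have hder : ∀ t ∈ uIcc (0 : ℝ) 1, HasDerivAt (fun t => D (γ x t)) (x i * D₂ (γ x t)) t := by
      intro t _
      have h1 : HasDerivAt (γ x) (x i • e) t := by
        have := ((((hasDerivAt_id t).sub_const 1).mul_const (x i)).smul_const e).const_add x
        simpa [hγ] using this
      have h2 := ((hDs.differentiable htop) (γ x t)).hasFDerivAt.comp_hasDerivAt t h1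
      rw [map_smul, smul_eq_mul] at h2
      exact h2
    have hγc : Continuous (γ x) := by fun_prop
    have hci : IntervalIntegrable (fun t => x i * D₂ (γ x t)) volume 0 1 :=
      (continuous_const.mul (hD₂s.continuous.comp hγc)).intervalIntegrable _ _
    have hint := intervalIntegral.integral_eq_sub_of_hasDerivAt hder hci
    have h0 : D (γ x 0) = 0 := by
      have hfix : reflect i (γ x 0) = γ x 0 := by
        rw [reflect_eq]
        simp [hγ, he]
      have := hDR (γ x 0)
      rw [hfix] at this
      linarith
    have h1 : γ x 1 = x := by simp [hγ]
    rw [h0, h1, sub_zero, intervalIntegral.integral_const_mul] at hint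
    exact hint.symm
  refine ⟨fun x => -∫ t in (0 : ℝ)..1, D₂ (γ x t), ?_, ?_, ?_, ?_⟩
  · refine ContDiff.neg (contDiff_intervalIntegral (f := fun p => D₂ (γ p.1 p.2)) ?_)
    exact hD₂s.comp (by fun_prop)
  · refine HasCompactSupport.intro hφc fun x hx => ?_
    by_cases hxi : x i = 0
    · have : D₂ x = 0 := image_eq_zero_of_notMem_tsupport fun h => hx (hD₂c h)
      simp [hγ, hxi, this]
    · have : D x = 0 := image_eq_zero_of_notMem_tsupport fun h => hx (hDc h)
      rw [hmain x] at this
      simpa [hxi] using this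
  · intro x
    have : ∀ t, γ (reflect i x) t = reflect i (γ x t) := fun t => by
      ext j
      by_cases hj : j = i
      · subst hj
        simp [hγ, reflect_apply, he]
        ring
      · simp [hγ, reflect_apply, he, hj]
    simp only [this, hD₂R]
  · intro x
    rw [mul_neg, neg_neg]
    exact hmain x

lemma exists_even_absMoment_update (i : Fin n) {φ : (Fin n → ℝ) → ℝ}
    (hφ : ContDiff ℝ (⊤ : ℕ∞) φ) (hφc : HasCompactSupport φ) (heven : ∀ x, φ (reflect i x) = φ x) :
    ∃ ψ : (Fin n → ℝ) → ℝ, ContDiff ℝ (⊤ : ℕ∞) ψ ∧ HasCompactSupport ψ ∧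
      (∀ x, ψ (reflect i x) = ψ x) ∧
      ∀ s : Fin n → ℂ, (∀ j, 0 < (s j).re) →
        (s i + 1) * absMoment s φ = absMoment (Function.update s i (s i + 2)) ψ := by
  obtain ⟨ψ, h1, h2, h3, h4⟩ := exists_even_fderiv_eq i hφ hφc heven
  refine ⟨ψ, h1, h2, h3, fun s hs => ?_⟩
  have h := integral_absMonomial_mul_fderiv i (hφ.of_le (by norm_cast)) hφc hs
  rw [← neg_eq_iff_eq_neg, ← integral_neg] at h
  rw [← h, absMoment]
  congr 1
  ext x
  rw [h4, absMonomial_update_add_two]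
  push_cast
  ring

lemma exists_even_absMoment_update_add (i : Fin n) (N : ℕ) {φ : (Fin n → ℝ) → ℝ}
    (hφ : ContDiff ℝ (⊤ : ℕ∞) φ) (hφc : HasCompactSupport φ) (heven : ∀ x, φ (reflect i x) = φ x) :
    ∃ ψ : (Fin n → ℝ) → ℝ, ContDiff ℝ (⊤ : ℕ∞) ψ ∧ HasCompactSupport ψ ∧
      (∀ x, ψ (reflect i x) = ψ x) ∧
      ∀ s : Fin n → ℂ, (∀ j, 0 < (s j).re) →
        (∏ r ∈ Finset.range N, (s i + 1 + 2 * r)) * absMoment s φ =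
          absMoment (Function.update s i (s i + 2 * N)) ψ := by
  induction N with
  | zero => exact ⟨φ, hφ, hφc, heven, fun s _ => by simp⟩
  | succ N ih =>
    obtain ⟨ψ, h1, h2, h3, h4⟩ := ih
    obtain ⟨χ, h5, h6, h7, h8⟩ := exists_even_absMoment_update i h1 h2 h3
    refine ⟨χ, h5, h6, h7, fun s hs => ?_⟩
    have hpos : ∀ j, 0 < (Function.update s i (s i + 2 * N) j).re := fun j => by
      by_cases hj : j = i
      · subst hj
        have := hs j
        simp
        positivity
      · rw [Function.update_of_ne hj]
        exact hs j
    have h := h8 _ hpos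
    rw [Function.update_self, Function.update_idem, ← h4 s hs] at h
    rw [Finset.prod_range_succ]
    push_cast
    convert! h using 1
    · ring
    · congr 2
      ring

/-- Integrating by parts repeatedly in the coordinates belonging to `T`. -/
lemma exists_absMoment_add (T : Finset (Fin n)) (N : ℕ) {φ : (Fin n → ℝ) → ℝ}
    (hφ : ContDiff ℝ (⊤ : ℕ∞) φ) (hφc : HasCompactSupport φ) :
    ∃ ψ : (Fin n → ℝ) → ℝ, ContDiff ℝ (⊤ : ℕ∞) ψ ∧ HasCompactSupport ψ ∧
      ∀ s : Fin n → ℂ, (∀ j, 0 < (s j).re) →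
        (∏ i ∈ T, ∏ r ∈ Finset.range N, (s i + 1 + 2 * r)) * absMoment s φ =
          absMoment (fun i => if i ∈ T then s i + 2 * N else s i) ψ := by
  classical
  induction T using Finset.induction_on with
  | empty => exact ⟨φ, hφ, hφc, fun s _ => by simp⟩
  | insert i T hi ih =>
    obtain ⟨ψ, h1, h2, h3⟩ := ih
    obtain ⟨χ, h4, h5, h6, h7⟩ := exists_even_absMoment_eq i h1 h2
    obtain ⟨ω, h8, h9, -, h10⟩ := exists_even_absMoment_update_add i N h4 h5 h6
    refine ⟨ω, h8, h9, fun s hs => ?_⟩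
    have hpos : ∀ j, 0 < (if j ∈ T then s j + 2 * N else s j).re := fun j => by
      have := hs j
      split_ifs
      · simp
        positivity
      · exact this
    have h := h10 _ hpos
    rw [h7 _ hpos, ← h3 s hs] at h
    simp only [hi, if_false] at h
    rw [Finset.prod_insert hi, mul_assoc, h]
    congr 1
    ext j
    by_cases hj : j = i
    · subst hj
      simp
    · simp [hj]

lemma differentiableOn_absMoment {a c : Fin n → ℂ} {U : Set ℂ} (hU : IsOpen U)
    (hpos : ∀ z ∈ U, ∀ i, 0 < (a i * z + c i).re) {φ : (Fin n → ℝ) → ℝ}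
    (hφ : Continuous φ) (hφc : HasCompactSupport φ) :
    DifferentiableOn ℂ (fun z => absMoment (fun i => a i * z + c i) φ) U := by
  refine differentiableOn_integral_of_continuousOn hU
    (f := fun z x => absMonomial (fun i => a i * z + c i) x * (φ x : ℂ)) ?_ ?_ hφc ?_
  · rintro ⟨z, x⟩ ⟨hz, -⟩
    refine ContinuousAt.continuousWithinAt (ContinuousAt.mul ?_ (by fun_prop))
    refine tendsto_finsetProd _ fun i _ => ?_
    exact ContinuousAt.comp (f := fun p : ℂ × (Fin n → ℝ) => (p.2 i, a i * p.1 + c i))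
      (g := fun q : ℝ × ℂ => absPow q.1 q.2) (x := (z, x))
      (continuousAt_absPow (hpos z hz i)) (by fun_prop)
  · intro x
    refine DifferentiableOn.mul ?_ (differentiableOn_const _)
    refine DifferentiableOn.fun_finsetProd fun i _ => ?_
    by_cases hx : x i = 0
    · simp only [absPow, hx, if_true]
      exact differentiableOn_const _
    · simp only [absPow, if_neg hx]
      refine DifferentiableOn.const_cpow (by fun_prop) (Or.inl ?_)
      simpa using hx
  · intro z x hx
    simp [image_eq_zero_of_notMem_tsupport hx]

end

/-- The low coefficients of a polynomial vanishing to order `p` along a filter are zero. -/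
lemma coeff_eq_zero_of_eval_eq_pow_mul {α : Type*} {L : Filter α} [NeBot L] {u : α → ℂ}
    (hu : Tendsto u L (𝓝[≠] 0)) {a : α → ℂ} {c : ℂ} (ha : Tendsto a L (𝓝 c)) (p : ℕ)
    (P : Polynomial ℂ) (h : ∀ᶠ z in L, P.eval (u z) = u z ^ p * a z) :
    ∀ j < p, P.coeff j = 0 := by
  have hu0 : Tendsto u L (𝓝 0) := hu.mono_right nhdsWithin_le_nhds
  have hune : ∀ᶠ z in L, u z ≠ 0 := hu.eventually self_mem_nhdsWithin
  induction p generalizing P with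
  | zero => simp
  | succ p ih =>
    have h0 : P.eval 0 = 0 := by
      have h1 : Tendsto (fun z => P.eval (u z)) L (𝓝 (P.eval 0)) :=
        (P.continuous.tendsto 0).comp hu0
      have h2 : Tendsto (fun z => u z ^ (p + 1) * a z) L (𝓝 (0 ^ (p + 1) * c)) :=
        (hu0.pow _).mul ha
      rw [zero_pow p.succ_ne_zero, zero_mul] at h2
      exact tendsto_nhds_unique (h1.congr' h) h2
    obtain ⟨R, rfl⟩ := Polynomial.X_dvd_iff.2
      ((Polynomial.coeff_zero_eq_eval_zero P).trans h0)
    have hR := ih R (by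
      filter_upwards [h, hune] with z hz hz0
      rw [Polynomial.eval_mul, Polynomial.eval_X, pow_succ'] at hz
      exact mul_left_cancel₀ hz0 (by rw [hz, mul_assoc]))
    intro j hj
    cases j with
    | zero => simp
    | succ j => rw [Polynomial.coeff_X_mul]; exact hR j (by omega)

/-- The factor `∏ (a z + c + 1 + 2 r)` is, up to a nonvanishing factor, `z + t` or `1` near `-t`,
according to whether `-t` is one of its zeros. -/
lemma exists_prod_linear_eq {a c t : ℝ} (ha : a ≠ 0) (N : ℕ) (p : Prop) [Decidable p]
    (hp : p ↔ ∃ r < N, a * t = c + 1 + 2 * (r : ℝ)) :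
    ∃ q : ℂ → ℂ, Continuous q ∧ q (-(t : ℂ)) ≠ 0 ∧ ∀ z : ℂ,
      ∏ r ∈ Finset.range N, ((a : ℂ) * z + (c : ℂ) + 1 + 2 * (r : ℂ)) =
        (if p then z + (t : ℂ) else 1) * q z := by
  have hzero : ∀ r : ℕ, (a : ℂ) * (-(t : ℂ)) + (c : ℂ) + 1 + 2 * (r : ℂ) = 0 →
      a * t = c + 1 + 2 * (r : ℝ) := fun r h => by
    have h' : a * (-t) + c + 1 + 2 * (r : ℝ) = 0 := by exact_mod_cast h
    linarith
  by_cases h : p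
  · obtain ⟨r₀, hr₀, hr⟩ := hp.1 h
    refine ⟨fun z => (a : ℂ) * ∏ r ∈ (Finset.range N).erase r₀,
      ((a : ℂ) * z + (c : ℂ) + 1 + 2 * (r : ℂ)), ?_, ?_, fun z => ?_⟩
    · exact continuous_const.mul (continuous_finsetProd _ fun r _ => by fun_prop)
    · refine mul_ne_zero (by exact_mod_cast ha) (Finset.prod_ne_zero_iff.2 fun r hr' h0 => ?_)
      have h1 := hzero r h0
      refine Finset.ne_of_mem_erase hr' ?_
      have : (r : ℝ) = r₀ := by linarith
      exact_mod_cast this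
    · rw [← Finset.mul_prod_erase _ _ (Finset.mem_range.2 hr₀), if_pos h, ← mul_assoc]
      congr 1
      have hr' : (a : ℂ) * t = c + 1 + 2 * (r₀ : ℂ) := by exact_mod_cast hr
      linear_combination -hr'
  · refine ⟨fun z => ∏ r ∈ Finset.range N, ((a : ℂ) * z + (c : ℂ) + 1 + 2 * (r : ℂ)), ?_, ?_,
      fun z => by simp [h]⟩
    · exact continuous_finsetProd _ fun r _ => by fun_prop
    · exact Finset.prod_ne_zero_iff.2 fun r hr h0 =>
        h (hp.2 ⟨r, Finset.mem_range.1 hr, hzero r h0⟩)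

/-- The part of the upper half plane to the right of the line `Re z = -c`. -/
def upperRight (c : ℝ) : Set ℂ := {z | 0 < z.im} ∩ {z | -c < z.re}

lemma isPreconnected_upperRight (c : ℝ) : IsPreconnected (upperRight c) :=
  ((convex_halfSpace_im_gt 0).inter (convex_halfSpace_re_gt (-c))).isPreconnected

lemma neBot_nhdsWithin_upperRight {c t : ℝ} (h : t < c) :
    NeBot (𝓝[upperRight c] (-(t : ℂ))) := by
  rw [← mem_closure_iff_nhdsWithin_neBot]
  have hc : Continuous fun y : ℝ => -(t : ℂ) + (y : ℂ) * Complex.I := by fun_prop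
  have ht : Tendsto (fun y : ℝ => -(t : ℂ) + (y : ℂ) * Complex.I) (𝓝[>] 0) (𝓝 (-(t : ℂ))) := by
    simpa using (hc.tendsto 0).mono_left nhdsWithin_le_nhds
  refine mem_closure_of_tendsto ht ?_
  filter_upwards [self_mem_nhdsWithin] with y hy
  exact ⟨by simpa using hy, by simpa using h⟩

/-- Let `-μ = -λ_j ∈ P` be a candidate pole of the meromorphic extension `F` of `H(φ)`, with
`S = S_j`, `ν_i` defined for `i ∈ S_j` by `(m_i+1+ν_i)/l_i = λ_j`, and let `1 ≤ k ≤ k_j = #S_j`.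
If every subset `T ⊆ S_j` with `#T = k` contains some `i` with `ν_i` odd, then the Laurent
coefficients of `H(φ)` at `λ = -λ_j` satisfy `b_{j,k} = ⋯ = b_{j,k_j} = 0`. -/
theorem stmt_9 (n : ℕ) (hn : 0 < n) (l m : Fin n → ℝ)
    (hl : ∀ i, 0 < l i) (hm : ∀ i, 0 ≤ m i)
    (φ : (Fin n → ℝ) → ℝ) (hφ : ContDiff ℝ (⊤ : ℕ∞) φ) (hφc : HasCompactSupport φ)
    (μ : ℝ) (S : Finset (Fin n))
    (hS : ∀ i : Fin n, i ∈ S ↔ ∃ r : ℕ, 0 < r ∧ (m i + (r : ℝ)) / l i = μ)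
    (hSne : S.Nonempty)
    (ν : Fin n → ℕ) (hν : ∀ i ∈ S, (m i + 1 + (ν i : ℝ)) / l i = μ)
    (k : ℕ) (hk1 : 1 ≤ k) (hk2 : k ≤ S.card)
    (hodd : ∀ T ⊆ S, T.card = k → ∃ i ∈ T, Odd (ν i))
    (F : ℂ → ℂ)
    (hFeq : ∀ lam : ℂ, -(⨅ i, (m i + 1) / l i) < lam.re → F lam = Hint n l m φ lam)
    (hFmero : ∀ lam : ℂ, (¬ ∃ t ∈ polesP n l m, lam = (t : ℂ)) → AnalyticAt ℂ F lam)
    (b : ℕ → ℝ) (g : ℂ → ℂ) (hg : AnalyticAt ℂ g (-(μ : ℂ)))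
    (hrep : ∀ᶠ lam in 𝓝[≠] (-(μ : ℂ)),
      F lam = g lam + ∑ k' ∈ Finset.Icc 1 S.card, (b k' : ℂ) * (lam + (μ : ℂ)) ^ (-(k' : ℤ))) :
    ∀ k' : ℕ, k ≤ k' → k' ≤ S.card → b k' = 0 := by
  classical
  obtain ⟨i₀, hi₀⟩ := hSne
  have hμ : 0 < μ := by
    rw [← hν i₀ hi₀]
    have := hm i₀
    have := hl i₀
    positivity
  obtain ⟨N, hN⟩ := exists_nat_gt (∑ i, l i * (μ + 1))
  have hNl : ∀ i, l i * (μ + 1) < m i + 2 * N := fun i => by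
    have h1 : l i * (μ + 1) ≤ ∑ i, l i * (μ + 1) :=
      Finset.single_le_sum (f := fun i => l i * (μ + 1))
        (fun j _ => mul_nonneg (hl j).le (by linarith)) (Finset.mem_univ i)
    have := hm i
    have : (0 : ℝ) ≤ N := N.cast_nonneg
    linarith
  set E := S.filter fun i => Even (ν i) with hE
  have hEk : E.card < k := by
    by_contra hcon
    obtain ⟨T, hTE, hTk⟩ := Finset.exists_subset_card_eq (not_lt.1 hcon)
    obtain ⟨i, hi, hio⟩ := hodd T (hTE.trans (Finset.filter_subset _ _)) hTk
    exact (Nat.not_even_iff_odd.2 hio) (Finset.mem_filter.1 (hTE hi)).2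
  have hEiff : ∀ i, i ∈ E ↔ ∃ r < N, l i * μ = m i + 1 + 2 * (r : ℝ) := fun i => by
    have hli := hl i
    rw [hE, Finset.mem_filter]
    constructor
    · rintro ⟨hi, r, hr⟩
      have h := hν i hi
      rw [div_eq_iff hli.ne', hr] at h
      push_cast at h
      refine ⟨r, ?_, by linarith⟩
      have := hNl i
      have : (r : ℝ) < N := by nlinarith
      exact_mod_cast this
    · rintro ⟨r, -, hr⟩
      have hi : i ∈ S := (hS i).2 ⟨2 * r + 1, by omega, by
        rw [div_eq_iff hli.ne']
        push_cast
        linarith⟩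
      have h := hν i hi
      rw [div_eq_iff hli.ne'] at h
      have h2 : (ν i : ℝ) = 2 * r := by linarith
      have h3 : ν i = 2 * r := by exact_mod_cast h2
      exact ⟨hi, r, by omega⟩
  choose q hqc hq0 hq using fun i => exists_prod_linear_eq (c := m i) (t := μ) (hl i).ne' N
    (i ∈ E) (hEiff i)
  obtain ⟨ψ, hψ, hψc, hψH⟩ := exists_absMoment_add Finset.univ N hφ hφc
  set K : ℂ → ℂ := fun z => absMoment (fun i => (l i : ℂ) * z + ((m i : ℂ) + 2 * N)) ψ with hK
  set A : ℂ → ℂ := fun z => ∏ i, q i z with hA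
  have hAc : Continuous A := continuous_finsetProd _ fun i _ => hqc i
  have hA0 : A (-(μ : ℂ)) ≠ 0 := Finset.prod_ne_zero_iff.2 fun i _ => hq0 i
  have hQ : ∀ z : ℂ, ∏ i, ∏ r ∈ Finset.range N, ((l i : ℂ) * z + (m i : ℂ) + 1 + 2 * (r : ℂ)) =
      (z + μ) ^ E.card * A z := fun z => by
    simp only [hq]
    rw [Finset.prod_mul_distrib, Finset.prod_ite_mem, Finset.univ_inter, Finset.prod_const]
  have hUo : IsOpen {z : ℂ | -(μ + 1) < z.re} := isOpen_lt continuous_const Complex.continuous_re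
  have hKd : DifferentiableOn ℂ K {z : ℂ | -(μ + 1) < z.re} := by
    refine differentiableOn_absMoment hUo (fun z hz i => ?_) hψ.continuous hψc
    have hz' : -(μ + 1) < z.re := hz
    have h1 := hNl i
    have h2 := mul_lt_mul_of_pos_left hz' (hl i)
    have h3 : ((l i : ℂ) * z + ((m i : ℂ) + 2 * N)).re = l i * z.re + (m i + 2 * N) := by simp
    rw [h3]
    linarith
  have hKa : ContinuousAt K (-(μ : ℂ)) :=
    (hKd.differentiableAt (hUo.mem_nhds (by simp))).continuousAt
  have hright : ∀ z : ℂ, 0 < z.re →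
      (∏ i, ∏ r ∈ Finset.range N, ((l i : ℂ) * z + (m i : ℂ) + 1 + 2 * (r : ℂ))) * F z = K z := by
    intro z hz
    have hinf : 0 ≤ ⨅ i, (m i + 1) / l i :=
      Real.iInf_nonneg fun i => div_nonneg (by linarith [hm i]) (hl i).le
    have hpos : ∀ i, 0 < ((l i : ℂ) * z + (m i : ℂ)).re := fun i => by
      have h1 : ((l i : ℂ) * z + (m i : ℂ)).re = l i * z.re + m i := by simp
      rw [h1]
      have := mul_pos (hl i) hz
      linarith [hm i]
    have h := hψH _ hpos
    rw [hFeq z (by linarith)]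
    simp only [Finset.mem_univ, if_true, add_assoc] at h
    simp only [hK, add_assoc]
    exact h
  have hWF : AnalyticOnNhd ℂ F (upperRight (μ + 1)) := fun z hz => by
    refine hFmero z ?_
    rintro ⟨t, -, rfl⟩
    exact absurd hz.1 (by simp)
  have hWeq : EqOn (fun z : ℂ => (∏ i, ∏ r ∈ Finset.range N,
      ((l i : ℂ) * z + (m i : ℂ) + 1 + 2 * (r : ℂ))) * F z) K (upperRight (μ + 1)) := by
    have hQd : Differentiable ℂ fun z : ℂ => ∏ i, ∏ r ∈ Finset.range N,
        ((l i : ℂ) * z + (m i : ℂ) + 1 + 2 * (r : ℂ)) := by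
      refine Differentiable.fun_finsetProd fun i _ => Differentiable.fun_finsetProd fun r _ => ?_
      fun_prop
    refine AnalyticOnNhd.eqOn_of_preconnected_of_eventuallyEq (z₀ := 1 + Complex.I)
      (fun z hz => (hQd.analyticAt z).mul (hWF z hz))
      (fun z hz => hKd.analyticAt (hUo.mem_nhds hz.2)) (isPreconnected_upperRight _) ?_ ?_
    · exact ⟨by simp, by simp; linarith⟩
    · have ho : IsOpen {z : ℂ | 0 < z.re} := isOpen_lt continuous_const Complex.continuous_re
      filter_upwards [ho.mem_nhds (show 0 < (1 + Complex.I).re by simp)] with z hz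
        using hright z hz
  have hne : NeBot (𝓝[upperRight (μ + 1)] (-(μ : ℂ))) := neBot_nhdsWithin_upperRight (by linarith)
  have hsub : 𝓝[upperRight (μ + 1)] (-(μ : ℂ)) ≤ 𝓝[≠] (-(μ : ℂ)) := by
    refine nhdsWithin_mono _ fun z hz => ?_
    rintro rfl
    exact absurd hz.1 (by simp)
  have hu0 : Tendsto (fun z : ℂ => z + (μ : ℂ)) (𝓝[upperRight (μ + 1)] (-(μ : ℂ))) (𝓝 0) := by
    have : Continuous fun z : ℂ => z + (μ : ℂ) := by fun_prop
    simpa using (this.tendsto (-(μ : ℂ))).mono_left nhdsWithin_le_nhds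
  have hune : ∀ᶠ z in 𝓝[upperRight (μ + 1)] (-(μ : ℂ)), z + (μ : ℂ) ≠ 0 := by
    filter_upwards [hsub self_mem_nhdsWithin] with z hz h0
    exact hz (eq_neg_of_add_eq_zero_left h0)
  have hlim : Tendsto (fun z => K z / A z - (z + (μ : ℂ)) ^ E.card * g z)
      (𝓝[upperRight (μ + 1)] (-(μ : ℂ)))
      (𝓝 (K (-(μ : ℂ)) / A (-(μ : ℂ)) - 0 ^ E.card * g (-(μ : ℂ)))) :=
    ((hKa.tendsto.mono_left nhdsWithin_le_nhds).div
      ((hAc.tendsto _).mono_left nhdsWithin_le_nhds) hA0).sub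
      ((hu0.pow _).mul (hg.continuousAt.tendsto.mono_left nhdsWithin_le_nhds))
  have hcoeff := coeff_eq_zero_of_eval_eq_pow_mul
    (tendsto_nhdsWithin_iff.2 ⟨hu0, hune⟩) hlim S.card
    (∑ k' ∈ Finset.Icc 1 S.card, Polynomial.monomial (E.card + S.card - k') (b k' : ℂ)) (by
      filter_upwards [hsub hrep, hune, self_mem_nhdsWithin,
        ((hAc.tendsto (-(μ : ℂ))).mono_left nhdsWithin_le_nhds).eventually_ne hA0]
        with z hz hz0 hzW hzA
      have h1 := hWeq hzW
      simp only [hQ] at h1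
      have h2 : K z / A z = (z + (μ : ℂ)) ^ E.card * F z := by
        rw [← h1]
        field_simp
      rw [h2, ← mul_sub, hz, add_sub_cancel_left, Polynomial.eval_finsetSum, Finset.mul_sum,
        Finset.mul_sum]
      refine Finset.sum_congr rfl fun k' hk' => ?_
      have hk'S := (Finset.mem_Icc.1 hk').2
      rw [Polynomial.eval_monomial, zpow_neg, zpow_natCast]
      have h3 : (z + (μ : ℂ)) ^ (E.card + S.card) =
          (z + (μ : ℂ)) ^ (E.card + S.card - k') * (z + (μ : ℂ)) ^ k' := by
        rw [← pow_add]
        congr 1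
        omega
      rw [pow_add] at h3
      field_simp
      linear_combination -(b k' : ℂ) * h3)
  intro k' hk hk'
  have h := hcoeff (E.card + S.card - k') (by omega)
  rw [Polynomial.finsetSum_coeff, Finset.sum_eq_single k'] at h
  · simpa using h
  · intro j hj hjk
    rw [Polynomial.coeff_monomial, if_neg]
    have := (Finset.mem_Icc.1 hj).2
    omega
  · intro h'
    exact absurd (Finset.mem_Icc.2 ⟨by omega, hk'⟩) h'
end

section
/- Let n ≥ 1, let l_1,…,l_n > 0 and m_1,…,m_n ≥ 0 be real numbers, and let φ : ℝ^n → ℝ be a smooth compactly supported function. Let -λ_j ∈ P be a candidate pole of the meromorphic extension of H(φ) such that k_j = #S_j = n, and for each 1 ≤ i ≤ n let ν_i ∈ ℤ_{≥0} be defined by (m_i+1+ν_i)/l_i = λ_j. Then the coefficient b_{j,n} of (λ+λ_j)^{-n} in the Laurent expansion of H(φ) at λ = -λ_j is given by b_{j,n} = ( ∏_{i=1}^n (1+(-1)^{ν_i})/(l_i ν_i!) ) · (∂^{ν_1+⋯+ν_n} φ / ∂x_1^{ν_1} ⋯ ∂x_n^{ν_n})(0). -/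
open MeasureTheory Filter Set
open scoped Topology

/-- The partial derivative `∂f/∂x_i`. -/
noncomputable def pderiv (n : ℕ) (i : Fin n) (f : (Fin n → ℝ) → ℝ) : (Fin n → ℝ) → ℝ :=
  fun x => deriv (fun t : ℝ => f (Function.update x i t)) (x i)

/-- Iterated partial derivatives along a list of coordinate directions. -/
noncomputable def mpderivList (n : ℕ) : List (Fin n) → ((Fin n → ℝ) → ℝ) → (Fin n → ℝ) → ℝ
  | [], f => f
  | i :: is, f => pderiv n i (mpderivList n is f)

/-- The mixed partial derivative `∂^(ν₁+⋯+ν_n) f / ∂x₁^(ν₁) ⋯ ∂x_n^(ν_n)`. -/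
noncomputable def mixedPartial (n : ℕ) (ν : Fin n → ℕ) (f : (Fin n → ℝ) → ℝ) :
    (Fin n → ℝ) → ℝ :=
  mpderivList n ((List.finRange n).flatMap fun i => List.replicate (ν i) i) f

open scoped ContDiff

theorem pderiv_eq_fderiv {n : ℕ} (i : Fin n) {f : (Fin n → ℝ) → ℝ} (hf : Differentiable ℝ f) :
    pderiv n i f = fun x => fderiv ℝ f x (Pi.single i 1) := by
  funext x
  have h : HasDerivAt (fun t : ℝ => f (Function.update x i t))
      (fderiv ℝ f x (Pi.single i 1)) (x i) := by
    have h1 := hasDerivAt_update x i (x i)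
    have h2 : HasFDerivAt f (fderiv ℝ f x) (Function.update x i (x i)) := by
      simpa using (hf x).hasFDerivAt
    exact h2.comp_hasDerivAt (x i) h1
  exact h.deriv

theorem ContDiff.pderiv {n : ℕ} (i : Fin n) {f : (Fin n → ℝ) → ℝ} (hf : ContDiff ℝ ∞ f) :
    ContDiff ℝ ∞ (pderiv n i f) := by
  rw [pderiv_eq_fderiv i (hf.differentiable (by simp))]
  exact (hf.fderiv_right (m := ∞) (by simp)).clm_apply contDiff_const

theorem HasCompactSupport.pderiv {n : ℕ} (i : Fin n) {f : (Fin n → ℝ) → ℝ}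
    (hf : ContDiff ℝ ∞ f) (hc : HasCompactSupport f) : HasCompactSupport (pderiv n i f) := by
  rw [pderiv_eq_fderiv i (hf.differentiable (by simp))]
  exact hc.fderiv_apply ℝ _

theorem ContDiff.mpderivList {n : ℕ} (L : List (Fin n)) {f : (Fin n → ℝ) → ℝ}
    (hf : ContDiff ℝ ∞ f) : ContDiff ℝ ∞ (mpderivList n L f) := by
  induction L with
  | nil => exact hf
  | cons i L ih => exact ih.pderiv i

theorem HasCompactSupport.mpderivList {n : ℕ} (L : List (Fin n)) {f : (Fin n → ℝ) → ℝ}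
    (hf : ContDiff ℝ ∞ f) (hc : HasCompactSupport f) :
    HasCompactSupport (mpderivList n L f) := by
  induction L with
  | nil => exact hc
  | cons i L ih => exact ih.pderiv i (hf.mpderivList L)

theorem mpderivList_append {n : ℕ} (L M : List (Fin n)) (f : (Fin n → ℝ) → ℝ) :
    mpderivList n (L ++ M) f = mpderivList n L (mpderivList n M f) := by
  induction L with
  | nil => rfl
  | cons i L ih => simp only [List.cons_append, mpderivList, ih]

theorem mpderivList_map_succ {n : ℕ} (L : List (Fin n)) (f : (Fin (n + 1) → ℝ) → ℝ) (t : ℝ)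
    (y : Fin n → ℝ) :
    mpderivList (n + 1) (L.map Fin.succ) f (Fin.cons t y) =
      mpderivList n L (fun z => f (Fin.cons t z)) y := by
  induction L generalizing y with
  | nil => rfl
  | cons i L ih =>
    simp only [List.map_cons, mpderivList, pderiv, Fin.cons_succ, ← Fin.cons_update, ih]

theorem absPow_zero (s : ℂ) : absPow 0 s = 0 := by simp [absPow]

theorem continuous_absPow {s : ℂ} (hs : 0 < s.re) : Continuous fun x : ℝ => absPow x s := by
  have h : (fun x : ℝ => absPow x s) = fun x : ℝ => ((|x| : ℝ) : ℂ) ^ s := by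
    funext x
    by_cases hx : x = 0
    · have : s ≠ 0 := by rintro rfl; simp at hs
      simp [absPow, hx, Complex.zero_cpow this]
    · simp [absPow, hx]
  rw [h]
  exact (Complex.continuous_ofReal_cpow_const hs).comp continuous_abs

theorem absPow_of_ne_zero_s10 {x : ℝ} (hx : x ≠ 0) (s : ℂ) :
    absPow x s = Complex.exp (s * (Real.log x : ℂ)) := by
  rw [absPow, if_neg hx, Complex.cpow_def_of_ne_zero (by simpa using hx),
    ← Complex.ofReal_log (abs_nonneg x), Real.log_abs, mul_comm]

theorem hasDerivAt_absPow_mul_pow {s : ℂ} (hs : 0 < s.re) (k : ℕ) (x : ℝ) :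
    HasDerivAt (fun t : ℝ => absPow t s * (t : ℂ) ^ (k + 1))
      ((s + k + 1) * (absPow x s * (x : ℂ) ^ k)) x := by
  by_cases hx : x = 0
  · subst hx
    rw [hasDerivAt_iff_tendsto_slope]
    have hc : Continuous fun t : ℝ => absPow t s * (t : ℂ) ^ k :=
      (continuous_absPow hs).mul (by fun_prop)
    have h0 := (hc.tendsto 0).mono_left (nhdsWithin_le_nhds (s := {(0 : ℝ)}ᶜ))
    simp only [absPow_zero, zero_mul, mul_zero] at h0 ⊢
    refine h0.congr' ?_
    filter_upwards [self_mem_nhdsWithin] with t ht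
    have ht' : (t : ℂ) ≠ 0 := by simpa using ht
    simp only [slope, vsub_eq_sub, sub_zero, absPow_zero, zero_mul, Complex.real_smul,
      Complex.ofReal_inv]
    field_simp
    ring
  · have hx' : (x : ℂ) ≠ 0 := by simpa using hx
    have hlog : HasDerivAt (fun t : ℝ => (Real.log t : ℂ)) ((x⁻¹ : ℝ) : ℂ) x :=
      (Real.hasDerivAt_log hx).ofReal_comp
    have hid : HasDerivAt (fun t : ℝ => (t : ℂ)) 1 x := by
      simpa using (hasDerivAt_id x).ofReal_comp
    have h := ((hlog.const_mul s).cexp).mul (hid.fun_pow (k + 1))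
    have hE : (fun t : ℝ => absPow t s * (t : ℂ) ^ (k + 1)) =ᶠ[𝓝 x]
        fun t : ℝ => Complex.exp (s * (Real.log t : ℂ)) * (t : ℂ) ^ (k + 1) := by
      filter_upwards [isOpen_ne.mem_nhds hx] with t ht
      rw [absPow_of_ne_zero_s10 ht]
    refine (h.congr_of_eventuallyEq hE).congr_deriv ?_
    rw [absPow_of_ne_zero_s10 hx, Nat.add_sub_cancel]
    push_cast
    field_simp
    ring

/-- The weight `∏ |xᵢ|^(sᵢ) xᵢ^(kᵢ)`. -/
noncomputable def monomialWeight {n : ℕ} (s : Fin n → ℂ) (k : Fin n → ℕ) (x : Fin n → ℝ) : ℂ :=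
  ∏ i, absPow (x i) (s i) * (x i : ℂ) ^ k i

theorem continuous_monomialWeight {n : ℕ} {s : Fin n → ℂ} (hs : ∀ i, 0 < (s i).re)
    (k : Fin n → ℕ) : Continuous (monomialWeight s k) := by
  refine continuous_finsetProd _ fun i _ => ?_
  exact ((continuous_absPow (hs i)).comp (continuous_apply i)).mul (by fun_prop)

theorem integrable_monomialWeight_mul {n : ℕ} {s : Fin n → ℂ} (hs : ∀ i, 0 < (s i).re)
    (k : Fin n → ℕ) {f : (Fin n → ℝ) → ℝ} (hf : Continuous f) (hc : HasCompactSupport f) :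
    Integrable fun x => monomialWeight s k x * (f x : ℂ) := by
  refine Continuous.integrable_of_hasCompactSupport ?_ ?_
  · exact (continuous_monomialWeight hs k).mul (by fun_prop)
  · exact (hc.comp_left (g := fun t : ℝ => (t : ℂ)) (by simp)).mul_left

theorem hasLineDerivAt_monomialWeight {n : ℕ} {s : Fin n → ℂ} (hs : ∀ i, 0 < (s i).re)
    (k : Fin n → ℕ) (i : Fin n) (x : Fin n → ℝ) :
    HasLineDerivAt ℝ (monomialWeight s (Function.update k i (k i + 1)))
      ((s i + k i + 1) * monomialWeight s k x) x (Pi.single i 1) := by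
  have h := (hasDerivAt_absPow_mul_pow (hs i) (k i) (x i))
  have h1 : HasDerivAt (fun t : ℝ => x i + t) 1 0 := by
    simpa using (hasDerivAt_id (0 : ℝ)).const_add (x i)
  have h2 := (HasDerivAt.scomp_of_eq (0 : ℝ) h h1 (by simp)).mul_const
    (∏ j ∈ Finset.univ.erase i, absPow (x j) (s j) * (x j : ℂ) ^ k j)
  unfold HasLineDerivAt
  convert! h2 using 1
  · funext t
    rw [monomialWeight, ← Finset.mul_prod_erase _ _ (Finset.mem_univ i)]
    congr 1
    · simp
    · refine Finset.prod_congr rfl fun j hj => ?_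
      have hj' : j ≠ i := Finset.ne_of_mem_erase hj
      simp [hj']
  · rw [monomialWeight, ← Finset.mul_prod_erase _ _ (Finset.mem_univ i)]
    simp [mul_assoc]

theorem integral_monomialWeight_mul_pderiv {n : ℕ} {s : Fin n → ℂ} (hs : ∀ i, 0 < (s i).re)
    (k : Fin n → ℕ) (i : Fin n) {f : (Fin n → ℝ) → ℝ} (hf : ContDiff ℝ ∞ f)
    (hc : HasCompactSupport f) :
    ∫ x, monomialWeight s (Function.update k i (k i + 1)) x * (pderiv n i f x : ℂ) =
      -((s i + k i + 1) * ∫ x, monomialWeight s k x * (f x : ℂ)) := by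
  have h := integral_bilinear_hasLineDerivAt_right_eq_neg_left_of_integrable
    (μ := (volume : Measure (Fin n → ℝ)))
    (f := monomialWeight s (Function.update k i (k i + 1)))
    (f' := fun x => (s i + k i + 1) * monomialWeight s k x)
    (g := fun x => (f x : ℂ)) (g' := fun x => (pderiv n i f x : ℂ))
    (v := Pi.single i 1) (B := ContinuousLinearMap.mul ℝ ℂ) ?_ ?_ ?_ ?_ ?_
  · simpa [mul_assoc, integral_const_mul] using h
  · simpa [mul_assoc] using
      (integrable_monomialWeight_mul hs k hf.continuous hc).const_mul (s i + k i + 1)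
  · exact integrable_monomialWeight_mul hs _ (hf.pderiv i).continuous (hc.pderiv i hf)
  · exact integrable_monomialWeight_mul hs _ hf.continuous hc
  · exact fun x _ => hasLineDerivAt_monomialWeight hs k i x
  · intro x _
    rw [pderiv_eq_fderiv i (hf.differentiable (by simp))]
    have h1 := ((hf.differentiable (by simp)) x).hasFDerivAt.hasLineDerivAt (Pi.single i 1)
    exact HasDerivAt.ofReal_comp h1

theorem prod_mul_integral_monomialWeight {n : ℕ} {s : Fin n → ℂ} (hs : ∀ i, 0 < (s i).re)
    (L : List (Fin n)) {f : (Fin n → ℝ) → ℝ} (hf : ContDiff ℝ ∞ f) (hc : HasCompactSupport f) :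
    (∏ i, ∏ k ∈ Finset.range (L.count i), (-(s i + k + 1))) *
        ∫ x, (∏ i, absPow (x i) (s i)) * (f x : ℂ) =
      ∫ x, monomialWeight s (fun i => L.count i) x * (mpderivList n L f x : ℂ) := by
  induction L with
  | nil => simp [monomialWeight, mpderivList]
  | cons i L ih =>
    have hcount : (fun j => (i :: L).count j) =
        Function.update (fun j => L.count j) i (L.count i + 1) := by
      funext j
      by_cases hj : j = i
      · subst hj; simp
      · simp [hj, List.count_cons_of_ne (Ne.symm hj)]
    have hprod : (∏ j, ∏ k ∈ Finset.range ((i :: L).count j), (-(s j + k + 1))) =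
        -(s i + L.count i + 1) * ∏ j, ∏ k ∈ Finset.range (L.count j), (-(s j + k + 1)) := by
      rw [← Finset.mul_prod_erase _ _ (Finset.mem_univ i),
        ← Finset.mul_prod_erase _ _ (Finset.mem_univ i), List.count_cons_self,
        Finset.prod_range_succ]
      have herase : ∏ j ∈ Finset.univ.erase i, ∏ k ∈ Finset.range ((i :: L).count j),
            (-(s j + k + 1)) =
          ∏ j ∈ Finset.univ.erase i, ∏ k ∈ Finset.range (L.count j), (-(s j + k + 1)) :=
        Finset.prod_congr rfl fun j hj => by
          rw [List.count_cons_of_ne (Ne.symm (Finset.ne_of_mem_erase hj))]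
      rw [herase]
      ring
    rw [hprod, mul_assoc, ih, hcount, mpderivList,
      integral_monomialWeight_mul_pderiv hs (fun j => L.count j) i (hf.mpderivList L)
        (hc.mpderivList L hf)]
    ring

theorem measurable_realSign : Measurable Real.sign :=
  Measurable.ite measurableSet_Iio measurable_const
    (Measurable.ite measurableSet_Ioi measurable_const measurable_const)

theorem abs_realSign_le_one (x : ℝ) : |Real.sign x| ≤ 1 := by
  rcases Real.sign_apply_eq x with h | h | h <;> simp [h]

theorem integral_sign_pow_mul_deriv (ν : ℕ) {f : ℝ → ℝ} (hf : ContDiff ℝ 1 f)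
    (hc : HasCompactSupport f) :
    ∫ t, Real.sign t ^ (ν + 1) * deriv f t = -(1 + (-1) ^ ν) * f 0 := by
  have hint : Integrable (deriv f) :=
    (hf.continuous_deriv le_rfl).integrable_of_hasCompactSupport hc.deriv
  have hint' : Integrable fun t => Real.sign t ^ (ν + 1) * deriv f t := by
    refine hint.bdd_mul (c := 1) (measurable_realSign.pow_const _).aestronglyMeasurable ?_
    refine Eventually.of_forall fun t => ?_
    rw [norm_pow]
    exact pow_le_one₀ (norm_nonneg _) (abs_realSign_le_one t)
  have hpos : ∫ t in Ioi (0 : ℝ), Real.sign t ^ (ν + 1) * deriv f t = - f 0 := by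
    rw [← hc.integral_Ioi_deriv_eq hf 0]
    refine setIntegral_congr_fun measurableSet_Ioi fun t ht => ?_
    simp [Real.sign_of_pos ht]
  have hneg : ∫ t in Iic (0 : ℝ), Real.sign t ^ (ν + 1) * deriv f t = (-1) ^ (ν + 1) * f 0 := by
    rw [← hc.integral_Iic_deriv_eq hf 0, integral_Iic_eq_integral_Iio,
      integral_Iic_eq_integral_Iio, ← integral_const_mul]
    refine setIntegral_congr_fun measurableSet_Iio fun t ht => ?_
    simp [Real.sign_of_neg ht]
  rw [← integral_add_compl (measurableSet_Iic (a := (0 : ℝ))) hint', compl_Iic, hpos, hneg]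
  ring

/-- The weight `∏ sign(xᵢ)^(νᵢ+1)`. -/
noncomputable def signWeight {n : ℕ} (ν : Fin n → ℕ) (x : Fin n → ℝ) : ℝ :=
  ∏ i, Real.sign (x i) ^ (ν i + 1)

theorem integrable_signWeight_mul {n : ℕ} (ν : Fin n → ℕ) {f : (Fin n → ℝ) → ℝ}
    (hf : Continuous f) (hc : HasCompactSupport f) :
    Integrable fun x => signWeight ν x * f x := by
  refine (hf.integrable_of_hasCompactSupport hc).bdd_mul (c := 1) ?_ ?_
  · refine Measurable.aestronglyMeasurable (Finset.measurable_prod _ fun i _ => ?_)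
    exact (measurable_realSign.comp (measurable_pi_apply i)).pow_const _
  · refine Eventually.of_forall fun x => ?_
    rw [signWeight, norm_prod]
    refine Finset.prod_le_one (fun i _ => norm_nonneg _) fun i _ => ?_
    rw [norm_pow]
    exact pow_le_one₀ (norm_nonneg _) (abs_realSign_le_one _)

theorem contDiff_finCons {n : ℕ} :
    ContDiff ℝ ∞ fun p : ℝ × (Fin n → ℝ) => (Fin.cons p.1 p.2 : Fin (n + 1) → ℝ) := by
  rw [contDiff_pi]
  intro i
  refine Fin.cases ?_ (fun j => ?_) i
  · simpa using contDiff_fst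
  · simpa [Function.comp_def] using (contDiff_apply ℝ ℝ j).comp (contDiff_snd (E := ℝ))

theorem hasCompactSupport_finCons_right {n : ℕ} {f : (Fin (n + 1) → ℝ) → ℝ}
    (hc : HasCompactSupport f) (t : ℝ) :
    HasCompactSupport fun y : Fin n → ℝ => f (Fin.cons t y) := by
  refine HasCompactSupport.of_support_subset_isCompact
    (hc.isCompact.image (f := fun x : Fin (n + 1) → ℝ => fun j : Fin n => x j.succ)
      (by fun_prop)) ?_
  intro y hy
  exact ⟨Fin.cons t y, subset_tsupport f hy, by simp⟩

theorem hasCompactSupport_finCons_left {n : ℕ} {f : (Fin (n + 1) → ℝ) → ℝ}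
    (hc : HasCompactSupport f) (y : Fin n → ℝ) :
    HasCompactSupport fun t : ℝ => f (Fin.cons t y) := by
  refine HasCompactSupport.of_support_subset_isCompact
    (hc.isCompact.image (f := fun x : Fin (n + 1) → ℝ => x 0) (by fun_prop)) ?_
  intro t ht
  exact ⟨Fin.cons t y, subset_tsupport f ht, by simp⟩

theorem integral_signWeight_mul_mpderivList {n : ℕ} (ν : Fin n → ℕ) {f : (Fin n → ℝ) → ℝ}
    (hf : ContDiff ℝ ∞ f) (hc : HasCompactSupport f) :
    ∫ x, signWeight ν x * mpderivList n (List.finRange n) f x =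
      (∏ i, -(1 + (-1 : ℝ) ^ ν i)) * f 0 := by
  induction n with
  | zero =>
    simp [signWeight, mpderivList, integral_unique, Measure.real, volume_pi]
    congr 1
  | succ n ih =>
    set D := mpderivList (n + 1) ((List.finRange n).map Fin.succ) f with hD
    have hDs : ContDiff ℝ ∞ D := hf.mpderivList _
    have hDc : HasCompactSupport D := hc.mpderivList _ hf
    have hint := integrable_signWeight_mul ν (hDs.pderiv 0).continuous (hDc.pderiv 0 hDs)
    have he := (volume_preserving_piFinSuccAbove (fun _ : Fin (n + 1) => ℝ) 0).symm
    have hcons : ∀ p : ℝ × (Fin n → ℝ),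
        (MeasurableEquiv.piFinSuccAbove (fun _ : Fin (n + 1) => ℝ) 0).symm p =
          (Fin.cons p.1 p.2 : Fin (n + 1) → ℝ) := fun p => by
      simp [MeasurableEquiv.piFinSuccAbove, Fin.insertNthEquiv]
    have hint' := (he.integrable_comp_emb (MeasurableEquiv.measurableEmbedding _)).2 hint
    rw [Measure.volume_eq_prod] at hint'
    simp only [Function.comp_def] at hint'
    rw [List.finRange_succ, mpderivList, ← hD, ← he.integral_comp' (fun x => _),
      Measure.volume_eq_prod, integral_prod_symm _ hint']
    have hinner : ∀ y : Fin n → ℝ,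
        ∫ t : ℝ, signWeight ν (Fin.cons t y : Fin (n + 1) → ℝ) *
            pderiv (n + 1) 0 D (Fin.cons t y : Fin (n + 1) → ℝ) =
          -(1 + (-1 : ℝ) ^ ν 0) * (signWeight (fun j => ν j.succ) y *
            mpderivList n (List.finRange n) (fun z => f (Fin.cons 0 z)) y) := by
      intro y
      have h1 := integral_sign_pow_mul_deriv (ν 0) (f := fun t => D (Fin.cons t y))
        ((hDs.comp (contDiff_finCons.comp (contDiff_prodMk_left y))).of_le (by norm_cast))
        (hasCompactSupport_finCons_left hDc y)
      rw [← mpderivList_map_succ, ← hD, mul_left_comm, ← h1, ← integral_const_mul]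
      refine integral_congr_ae (Eventually.of_forall fun t => ?_)
      simp only [signWeight, Fin.prod_univ_succ, Fin.cons_zero, Fin.cons_succ, pderiv,
        Fin.update_cons_zero]
      ring
    simp only [hcons, hinner]
    rw [integral_const_mul, ih (fun j => ν j.succ)
      (f := fun z => f (Fin.cons 0 z))
      (hf.comp (contDiff_finCons.comp (contDiff_prodMk_right (0 : ℝ))))
      (hasCompactSupport_finCons_right hc 0), Fin.prod_univ_succ, mul_assoc]
    congr 3
    funext i
    refine Fin.cases rfl (fun j => rfl) i

theorem norm_cexp_mul_le {α : Type*} {L : α → ℝ} {w : α → ℂ} {K : ℝ}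
    (hK : ∀ x, w x ≠ 0 → L x ≤ K) {z : ℂ} (hz : 0 ≤ z.re) (x : α) :
    ‖Complex.exp (z * L x) * w x‖ ≤ Real.exp (z.re * K) * ‖w x‖ := by
  by_cases hx : w x = 0
  · simp [hx]
  · rw [norm_mul, Complex.norm_exp, Complex.re_mul_ofReal]
    gcongr
    exact hK x hx

theorem abs_mul_exp_le {a A K t : ℝ} (ha : 0 < a) (hA : a ≤ A) (hK0 : 0 ≤ K) (ht : t ≤ K) :
    |t| * Real.exp (a * t) ≤ K * Real.exp (A * K) + 1 / a := by
  have h1a : 0 ≤ 1 / a := by positivity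
  rcases le_or_gt 0 t with h | h
  · rw [abs_of_nonneg h]
    have : t * Real.exp (a * t) ≤ K * Real.exp (A * K) := by
      have hA0 : 0 ≤ A := ha.le.trans hA
      gcongr
    linarith
  · rw [abs_of_neg h]
    have h1 := Real.add_one_le_exp (-(a * t))
    rw [Real.exp_neg] at h1
    have hpos := Real.exp_pos (a * t)
    have h2 : -(a * t) * Real.exp (a * t) ≤ 1 := by
      calc -(a * t) * Real.exp (a * t) ≤ (Real.exp (a * t))⁻¹ * Real.exp (a * t) := by
            gcongr; linarith
        _ = 1 := inv_mul_cancel₀ hpos.ne'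
    have h3 : -t * Real.exp (a * t) ≤ 1 / a := by
      rw [le_div_iff₀ ha]; linarith
    have : 0 ≤ K * Real.exp (A * K) := by positivity
    linarith

section ExpIntegral

variable {α : Type*} [MeasurableSpace α] {P : Measure α} {L : α → ℝ} {w : α → ℂ} {K : ℝ}

theorem aestronglyMeasurable_cexp_mul (hL : Measurable L) (hw : Integrable w P) (z : ℂ) :
    AEStronglyMeasurable (fun x => Complex.exp (z * L x) * w x) P :=
  Measurable.aestronglyMeasurable (by fun_prop) |>.mul hw.aestronglyMeasurable

theorem continuousWithinAt_integral_cexp_mul (hL : Measurable L) (hw : Integrable w P)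
    (hK0 : 0 ≤ K) (hK : ∀ x, w x ≠ 0 → L x ≤ K) :
    ContinuousWithinAt (fun z : ℂ => ∫ x, Complex.exp (z * L x) * w x ∂P)
      {z | 0 < z.re ∧ 0 < z.im} 0 := by
  refine continuousWithinAt_of_dominated (bound := fun x => Real.exp K * ‖w x‖) ?_ ?_ ?_ ?_
  · exact Eventually.of_forall fun z => aestronglyMeasurable_cexp_mul hL hw z
  · have h1 : ∀ᶠ z : ℂ in 𝓝[{z | 0 < z.re ∧ 0 < z.im}] 0, z.re < 1 :=
      nhdsWithin_le_nhds ((isOpen_lt Complex.continuous_re continuous_const).mem_nhds (by simp))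
    filter_upwards [self_mem_nhdsWithin, h1] with z hz hz1
    refine Eventually.of_forall fun x => (norm_cexp_mul_le hK hz.1.le x).trans ?_
    gcongr
    nlinarith
  · exact hw.norm.const_mul _
  · refine Eventually.of_forall fun x => Continuous.continuousWithinAt ?_
    fun_prop

theorem differentiableAt_integral_cexp_mul (hL : Measurable L) (hw : Integrable w P)
    (hK0 : 0 ≤ K) (hK : ∀ x, w x ≠ 0 → L x ≤ K) {z₀ : ℂ} (hz₀ : 0 < z₀.re) :
    DifferentiableAt ℂ (fun z : ℂ => ∫ x, Complex.exp (z * L x) * w x ∂P) z₀ := by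
  set r := z₀.re with hr
  have hs : {z : ℂ | r / 2 < z.re ∧ z.re < 2 * r} ∈ 𝓝 z₀ := by
    refine IsOpen.mem_nhds ?_ ⟨by linarith, by linarith⟩
    exact (isOpen_lt continuous_const Complex.continuous_re).inter
      (isOpen_lt Complex.continuous_re continuous_const)
  refine (hasDerivAt_integral_of_dominated_loc_of_deriv_le
    (F := fun (z : ℂ) x => Complex.exp (z * L x) * w x)
    (F' := fun (z : ℂ) x => Complex.exp (z * L x) * L x * w x)
    (bound := fun x => (K * Real.exp (2 * r * K) + 1 / (r / 2)) * ‖w x‖)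
    hs ?_ ?_ ?_ ?_ ?_ ?_).2.differentiableAt
  · exact Eventually.of_forall fun z => aestronglyMeasurable_cexp_mul hL hw z
  · refine Integrable.mono' (hw.norm.const_mul (Real.exp (z₀.re * K)))
      (aestronglyMeasurable_cexp_mul hL hw z₀) (Eventually.of_forall fun x => ?_)
    exact norm_cexp_mul_le hK hz₀.le x
  · exact Measurable.aestronglyMeasurable (by fun_prop) |>.mul hw.aestronglyMeasurable
  · refine Eventually.of_forall fun x z hz => ?_
    by_cases hx : w x = 0
    · simp [hx]
    · rw [norm_mul, norm_mul, Complex.norm_exp, Complex.re_mul_ofReal, Complex.norm_real,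
        Real.norm_eq_abs, mul_comm (Real.exp _)]
      gcongr
      refine (abs_mul_exp_le (by linarith [hz.1]) hz.2.le hK0 (hK x hx)).trans ?_
      have := hz.1.le
      gcongr
  · exact hw.norm.const_mul _
  · refine Eventually.of_forall fun x z _ => ?_
    have h := (((hasDerivAt_id z).mul_const (L x : ℂ)).cexp).mul_const (w x)
    simpa using h

end ExpIntegral

theorem absPow_mul_pow_eq (a : ℂ) (ν : ℕ) (x : ℝ) :
    absPow x (a - (ν + 1)) * (x : ℂ) ^ (ν + 1) =
      Complex.exp (a * Real.log x) * ((Real.sign x : ℝ) : ℂ) ^ (ν + 1) := by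
  by_cases hx : x = 0
  · simp [hx]
  · have habs : (0 : ℝ) < |x| := abs_pos.2 hx
    have hexp : Complex.exp (Real.log x) = (|x| : ℝ) := by
      rw [← Real.log_abs, ← Complex.ofReal_exp, Real.exp_log habs]
    have hne : ((|x| : ℝ) : ℂ) ≠ 0 := by exact_mod_cast habs.ne'
    have hsign : (x : ℂ) = (Real.sign x : ℝ) * (|x| : ℝ) := by
      rcases lt_or_gt_of_ne hx with h | h
      · simp [Real.sign_of_neg h, abs_of_neg h]
      · simp [Real.sign_of_pos h, abs_of_pos h]
    have hsplit : (a - (ν + 1)) * (Real.log x : ℂ) =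
        a * Real.log x - ((ν + 1 : ℕ) : ℂ) * Real.log x := by push_cast; ring
    rw [absPow_of_ne_zero_s10 hx, hsplit, Complex.exp_sub, Complex.exp_nat_mul, hexp]
    conv_lhs => rw [hsign]
    rw [mul_pow]
    field_simp

theorem monomialWeight_eq_cexp_mul_signWeight {n : ℕ} (l : Fin n → ℝ) (ν : Fin n → ℕ) (z : ℂ)
    (x : Fin n → ℝ) :
    monomialWeight (fun i => l i * z - (ν i + 1)) (fun i => ν i + 1) x =
      Complex.exp (z * ((∑ i, l i * Real.log (x i) : ℝ) : ℂ)) * (signWeight ν x : ℂ) := by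
  simp only [monomialWeight, absPow_mul_pow_eq, Finset.prod_mul_distrib, signWeight]
  rw [← Complex.exp_sum]
  push_cast
  rw [Finset.mul_sum]
  congr 2
  exact Finset.sum_congr rfl fun i _ => by ring

theorem exists_sum_mul_log_le {n : ℕ} {l : Fin n → ℝ} (hl : ∀ i, 0 < l i)
    {f : (Fin n → ℝ) → ℝ} (hc : HasCompactSupport f) :
    ∃ K, 0 ≤ K ∧ ∀ x, f x ≠ 0 → ∑ i, l i * Real.log (x i) ≤ K := by
  obtain ⟨R, hR⟩ := hc.isCompact.isBounded.exists_norm_le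
  refine ⟨∑ i, l i * |R|, Finset.sum_nonneg fun i _ => mul_nonneg (hl i).le (abs_nonneg R),
    fun x hx => Finset.sum_le_sum fun i _ => ?_⟩
  have h1 : Real.log (x i) ≤ |x i| := by
    rw [← Real.log_abs]
    exact Real.log_le_self (abs_nonneg _)
  have h2 : |x i| ≤ R := (norm_le_pi_norm x i).trans (hR x (subset_tsupport f hx))
  exact mul_le_mul_of_nonneg_left (h1.trans (h2.trans (le_abs_self R))) (hl i).le

theorem count_finRange_append_flatMap_replicate {n : ℕ} (ν : Fin n → ℕ) (i : Fin n) :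
    (List.finRange n ++ (List.finRange n).flatMap fun j => List.replicate (ν j) j).count i =
      ν i + 1 := by
  rw [List.count_append, List.count_flatMap,
    List.count_eq_one_of_mem (List.nodup_finRange n) (List.mem_finRange i)]
  have h : (List.map (List.count i ∘ fun j => List.replicate (ν j) j) (List.finRange n)).sum =
      ∑ j, if j = i then ν j else 0 := by
    rw [Fin.sum_univ_def]
    simp [Function.comp_def, List.count_replicate]
  rw [h, Finset.sum_ite_eq' Finset.univ i]
  simp [add_comm]

theorem prod_range_succ_linear {n : ℕ} (l : Fin n → ℝ) (ν : Fin n → ℕ) (z : ℂ) :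
    ∏ i, ∏ k ∈ Finset.range (ν i + 1), (-(l i * z - (ν i + 1) + k + 1)) =
      z ^ n * ∏ i, (-(l i : ℂ) * ∏ k ∈ Finset.range (ν i), ((ν i : ℂ) - k - l i * z)) := by
  have h : z ^ n = ∏ _i : Fin n, z := by simp
  rw [h, ← Finset.prod_mul_distrib]
  refine Finset.prod_congr rfl fun i _ => ?_
  rw [Finset.prod_range_succ, Finset.prod_congr rfl fun (k : ℕ) _ =>
    show -((l i : ℂ) * z - (ν i + 1) + k + 1) = (ν i : ℂ) - k - l i * z by ring]
  ring

theorem prod_range_sub_eq_factorial (ν : ℕ) :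
    ∏ k ∈ Finset.range ν, ((ν : ℂ) - k) = (Nat.factorial ν : ℂ) := by
  rw [← Finset.prod_range_reflect, ← Finset.prod_range_add_one_eq_factorial]
  push_cast
  refine Finset.prod_congr rfl fun k hk => ?_
  have hk' : k < ν := Finset.mem_range.1 hk
  rw [Nat.cast_sub (by omega), Nat.cast_sub (by omega)]
  push_cast
  ring

theorem prod_mul_Hint_eq {n : ℕ} {l m : Fin n → ℝ} (hl : ∀ i, 0 < l i) (hm : ∀ i, 0 ≤ m i)
    {φ : (Fin n → ℝ) → ℝ} (hφ : ContDiff ℝ ∞ φ) (hφc : HasCompactSupport φ)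
    {μ : ℝ} {ν : Fin n → ℕ} (hν : ∀ i, (m i + 1 + (ν i : ℝ)) / l i = μ)
    {z : ℂ} (hz : 0 < (-(μ : ℂ) + z).re) :
    (z ^ n * ∏ i, (-(l i : ℂ) * ∏ k ∈ Finset.range (ν i), ((ν i : ℂ) - k - l i * z))) *
        Hint n l m φ (-(μ : ℂ) + z) =
      ∫ x, Complex.exp (z * ((∑ i, l i * Real.log (x i) : ℝ) : ℂ)) *
        ((signWeight ν x * mpderivList n (List.finRange n) (mixedPartial n ν φ) x : ℝ) : ℂ) := by
  have hexp : ∀ i, (l i : ℂ) * (-(μ : ℂ) + z) + m i = l i * z - (ν i + 1) := by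
    intro i
    have h : m i + 1 + (ν i : ℝ) = μ * l i := (div_eq_iff (hl i).ne').1 (hν i)
    have h' : (m i : ℂ) + 1 + ν i = μ * l i := by exact_mod_cast h
    linear_combination h'
  have hre : ∀ i, 0 < ((l i : ℂ) * z - (ν i + 1)).re := by
    intro i
    rw [← hexp i, Complex.add_re, Complex.re_ofReal_mul, Complex.ofReal_re]
    exact add_pos_of_pos_of_nonneg (mul_pos (hl i) hz) (hm i)
  have h := prod_mul_integral_monomialWeight hre
    (List.finRange n ++ (List.finRange n).flatMap fun j => List.replicate (ν j) j) hφ hφc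
  simp only [count_finRange_append_flatMap_replicate, mpderivList_append,
    prod_range_succ_linear, monomialWeight_eq_cexp_mul_signWeight] at h
  simp only [Hint, hexp, h, mixedPartial, Complex.ofReal_mul, mul_assoc]

theorem tendsto_pow_mul_of_laurent {n : ℕ} (hn : 0 < n) {F g : ℂ → ℂ} {b : ℕ → ℝ} {μ : ℝ}
    (hg : AnalyticAt ℂ g (-(μ : ℂ)))
    (hrep : ∀ᶠ lam in 𝓝[≠] (-(μ : ℂ)),
      F lam = g lam + ∑ k ∈ Finset.Icc 1 n, (b k : ℂ) * (lam + (μ : ℂ)) ^ (-(k : ℤ))) :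
    Tendsto (fun z : ℂ => z ^ n * F (-(μ : ℂ) + z)) (𝓝[≠] 0) (𝓝 (b n : ℂ)) := by
  have hcont : ContinuousAt (fun z : ℂ => z ^ n * g (-(μ : ℂ) + z) +
      ∑ k ∈ Finset.Icc 1 n, (b k : ℂ) * z ^ (n - k)) 0 := by
    have hg' : ContinuousAt (fun z : ℂ => g (-(μ : ℂ) + z)) 0 := by
      refine ContinuousAt.comp (g := g) ?_ (by fun_prop)
      simpa using hg.continuousAt
    exact ((continuousAt_id.pow n).mul hg').add (by fun_prop)
  have hval : (0 : ℂ) ^ n * g (-(μ : ℂ) + 0) +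
      ∑ k ∈ Finset.Icc 1 n, (b k : ℂ) * 0 ^ (n - k) = b n := by
    rw [zero_pow hn.ne', zero_mul, zero_add,
      Finset.sum_eq_single_of_mem n (Finset.mem_Icc.2 ⟨hn, le_rfl⟩)]
    · simp
    · intro k hk hkn
      have := Finset.mem_Icc.1 hk
      rw [zero_pow (by omega), mul_zero]
  have hlim := hcont.tendsto.mono_left (nhdsWithin_le_nhds (s := {(0 : ℂ)}ᶜ))
  simp only [hval] at hlim
  refine hlim.congr' ?_
  have hmap : Tendsto (fun z : ℂ => -(μ : ℂ) + z) (𝓝[≠] 0) (𝓝[≠] (-(μ : ℂ))) := by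
    refine tendsto_nhdsWithin_iff.2 ⟨?_, ?_⟩
    · have h : ContinuousAt (fun z : ℂ => -(μ : ℂ) + z) 0 := by fun_prop
      simpa using h.tendsto.mono_left (nhdsWithin_le_nhds (s := {(0 : ℂ)}ᶜ))
    · filter_upwards [self_mem_nhdsWithin] with z hz
      simpa using hz
  filter_upwards [hmap.eventually hrep, self_mem_nhdsWithin] with z hz hz0
  have hz0' : z ≠ 0 := hz0
  rw [hz, mul_add, Finset.mul_sum]
  congr 1
  refine Finset.sum_congr rfl fun k hk => ?_
  have hk' := (Finset.mem_Icc.1 hk).2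
  rw [show -(μ : ℂ) + z + μ = z by ring, zpow_neg, zpow_natCast, pow_sub₀ z hz0' hk']
  ring

/-- If `-μ = -λ_j ∈ P` is a candidate pole of the meromorphic extension `F` of `H(φ)` with
`k_j = #S_j = n` and `(m_i+1+ν_i)/l_i = λ_j` for all `i`, then the coefficient `b_{j,n}` of
`(λ+λ_j)^{-n}` in the Laurent expansion of `H(φ)` at `λ = -λ_j` equals
`(∏_i (1+(-1)^(ν_i))/(l_i ν_i!)) ∂^(ν₁+⋯+ν_n)φ/∂x^ν (0)`. -/
theorem stmt_10 (n : ℕ) (hn : 0 < n) (l m : Fin n → ℝ)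
    (hl : ∀ i, 0 < l i) (hm : ∀ i, 0 ≤ m i)
    (φ : (Fin n → ℝ) → ℝ) (hφ : ContDiff ℝ (⊤ : ℕ∞) φ) (hφc : HasCompactSupport φ)
    (μ : ℝ) (ν : Fin n → ℕ) (hν : ∀ i, (m i + 1 + (ν i : ℝ)) / l i = μ)
    (F : ℂ → ℂ)
    (hFeq : ∀ lam : ℂ, -(⨅ i, (m i + 1) / l i) < lam.re → F lam = Hint n l m φ lam)
    (hFmero : ∀ lam : ℂ, (¬ ∃ t ∈ polesP n l m, lam = (t : ℂ)) → AnalyticAt ℂ F lam)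
    (b : ℕ → ℝ) (g : ℂ → ℂ) (hg : AnalyticAt ℂ g (-(μ : ℂ)))
    (hrep : ∀ᶠ lam in 𝓝[≠] (-(μ : ℂ)),
      F lam = g lam + ∑ k ∈ Finset.Icc 1 n, (b k : ℂ) * (lam + (μ : ℂ)) ^ (-(k : ℤ))) :
    b n = (∏ i, (1 + (-1 : ℝ) ^ (ν i)) / (l i * (Nat.factorial (ν i) : ℝ))) *
      mixedPartial n ν φ 0 := by
  set ψ := mixedPartial n ν φ with hψ
  have hψs : ContDiff ℝ ∞ ψ := hφ.mpderivList _
  have hψc : HasCompactSupport ψ := hφc.mpderivList _ hφ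
  set D := mpderivList n (List.finRange n) ψ with hD
  have hDs : ContDiff ℝ ∞ D := hψs.mpderivList _
  have hDc : HasCompactSupport D := hψc.mpderivList _ hψs
  set L : (Fin n → ℝ) → ℝ := fun x => ∑ i, l i * Real.log (x i) with hLdef
  have hL : Measurable L := Finset.measurable_sum _ fun i _ =>
    (Real.measurable_log.comp (measurable_pi_apply i)).const_mul _
  set w : (Fin n → ℝ) → ℂ := fun x => ((signWeight ν x * D x : ℝ) : ℂ) with hwdef
  have hw : Integrable w := (integrable_signWeight_mul ν hDs.continuous hDc).ofReal
  obtain ⟨K, hK0, hK⟩ := exists_sum_mul_log_le hl hDc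
  have hKw : ∀ x, w x ≠ 0 → L x ≤ K := fun x hx => hK x fun h => hx (by simp [hwdef, h])
  set G : ℂ → ℂ := fun z => ∫ x, Complex.exp (z * L x) * w x with hGdef
  set R : ℂ → ℂ := fun z =>
    ∏ i, (-(l i : ℂ) * ∏ k ∈ Finset.range (ν i), ((ν i : ℂ) - k - l i * z)) with hRdef
  have hRdiff : Differentiable ℂ R := by
    simp only [hRdef]
    fun_prop
  set U : Set ℂ := {z | 0 < z.re ∧ 0 < z.im} with hU
  have hUopen : IsOpen U := (isOpen_lt continuous_const Complex.continuous_re).inter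
    (isOpen_lt continuous_const Complex.continuous_im)
  have hUconn : IsPreconnected U :=
    ((convex_halfSpace_re_gt 0).inter (convex_halfSpace_im_gt 0)).isPreconnected
  have hG : AnalyticOnNhd ℂ G U := DifferentiableOn.analyticOnNhd (fun z hz =>
    (differentiableAt_integral_cexp_mul hL hw hK0 hKw hz.1).differentiableWithinAt) hUopen
  have hlhs : AnalyticOnNhd ℂ (fun z => (z ^ n * R z) * F (-(μ : ℂ) + z)) U := by
    refine DifferentiableOn.analyticOnNhd (fun z hz => ?_) hUopen
    have hF : DifferentiableAt ℂ F (-(μ : ℂ) + z) := by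
      refine (hFmero _ ?_).differentiableAt
      rintro ⟨t, -, ht⟩
      have him := congrArg Complex.im ht
      simp only [Complex.add_im, Complex.neg_im, Complex.ofReal_im, neg_zero, zero_add] at him
      exact hz.2.ne' him
    have hF' : DifferentiableAt ℂ (fun z => F (-(μ : ℂ) + z)) z :=
      DifferentiableAt.comp z hF (by fun_prop)
    exact (((differentiableAt_id.pow n).mul (hRdiff z)).mul hF').differentiableWithinAt
  have hinf : 0 ≤ ⨅ i, (m i + 1) / l i :=
    Real.iInf_nonneg fun i => div_nonneg (by linarith [hm i]) (hl i).le
  have heq : EqOn (fun z => (z ^ n * R z) * F (-(μ : ℂ) + z)) G U := by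
    have hz₀ : (⟨|μ| + 1, 1⟩ : ℂ) ∈ U := ⟨by positivity, one_pos⟩
    refine hlhs.eqOn_of_preconnected_of_eventuallyEq hG hUconn hz₀ ?_
    have hnear : {z : ℂ | |μ| < z.re} ∈ 𝓝 (⟨|μ| + 1, 1⟩ : ℂ) :=
      (isOpen_lt continuous_const Complex.continuous_re).mem_nhds (by simp)
    filter_upwards [hnear] with z hz
    have hz' : 0 < (-(μ : ℂ) + z).re := by
      have : μ < z.re := (le_abs_self μ).trans_lt hz
      simpa using this
    rw [hFeq _ (by linarith)]
    exact prod_mul_Hint_eq hl hm hφ hφc hν hz'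
  have hle : 𝓝[U] (0 : ℂ) ≤ 𝓝[≠] 0 := nhdsWithin_mono _ fun z hz h => by
    have : z = 0 := h
    simp [this, hU] at hz
  have hne : (𝓝[U] (0 : ℂ)).NeBot := by
    have hpath : Tendsto (fun t : ℝ => (t : ℂ) * (1 + Complex.I)) (𝓝[>] 0) (𝓝[U] 0) := by
      refine tendsto_nhdsWithin_iff.2 ⟨?_, ?_⟩
      · have h : ContinuousAt (fun t : ℝ => (t : ℂ) * (1 + Complex.I)) 0 := by fun_prop
        simpa using h.tendsto.mono_left (nhdsWithin_le_nhds (s := Ioi (0 : ℝ)))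
      · filter_upwards [self_mem_nhdsWithin] with t ht
        have ht' : 0 < t := ht
        simp [hU, ht']
    exact hpath.neBot
  have hlim1 : Tendsto G (𝓝[U] 0) (𝓝 (G 0)) :=
    continuousWithinAt_integral_cexp_mul hL hw hK0 hKw
  have hlim2 : Tendsto G (𝓝[U] 0) (𝓝 (R 0 * b n)) := by
    refine Tendsto.congr' (f₁ := fun z => R z * (z ^ n * F (-(μ : ℂ) + z))) ?_ ?_
    · filter_upwards [self_mem_nhdsWithin] with z hz
      rw [← heq hz]
      ring
    · exact ((hRdiff.continuous.tendsto 0).mono_left nhdsWithin_le_nhds).mul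
        ((tendsto_pow_mul_of_laurent hn hg hrep).mono_left hle)
  have hkey := tendsto_nhds_unique hlim1 hlim2
  have hG0 : G 0 = (((∏ i, -(1 + (-1 : ℝ) ^ ν i)) * ψ 0 : ℝ) : ℂ) := by
    rw [← integral_signWeight_mul_mpderivList ν hψs hψc, ← integral_complex_ofReal]
    simp only [hGdef, hwdef, hD, zero_mul, Complex.exp_zero, one_mul]
  have hR0 : R 0 = ((∏ i, -(l i * (Nat.factorial (ν i) : ℝ)) : ℝ) : ℂ) := by
    simp only [hRdef, mul_zero, sub_zero, prod_range_sub_eq_factorial]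
    push_cast
    simp only [neg_mul]
  rw [hG0, hR0, ← Complex.ofReal_mul, Complex.ofReal_inj] at hkey
  have hden : ∏ i, -(l i * (Nat.factorial (ν i) : ℝ)) ≠ 0 :=
    Finset.prod_ne_zero_iff.2 fun i _ =>
      neg_ne_zero.2 (mul_ne_zero (hl i).ne' (Nat.cast_ne_zero.2 (Nat.factorial_ne_zero _)))
  have hprod : ∏ i, (1 + (-1 : ℝ) ^ (ν i)) / (l i * (Nat.factorial (ν i) : ℝ)) =
      (∏ i, -(1 + (-1 : ℝ) ^ ν i)) / ∏ i, -(l i * (Nat.factorial (ν i) : ℝ)) := by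
    rw [← Finset.prod_div_distrib]
    exact Finset.prod_congr rfl fun i _ => (neg_div_neg_eq _ _).symm
  rw [hprod, div_mul_eq_mul_div, hkey, mul_div_cancel_left₀ _ hden]
end
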